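/- Let n ≥ 1, δ > (n-1)/2, q ∈ (0,1], p ∈ [q,∞), and assume 2n/(n+1+2δ) ≤ q. Then there exists a constant C > 0 such that for every Schwartz function f on ℝ^n and every ε > 0, ‖B^δ_{1/ε}(f)‖_{WM^p_q} ≤ C ‖M(f,Φ)‖_{M^p_q}; that is, the Bochner–Riesz means of order δ is bounded from the Hardy–Morrey space HM^p_q(ℝ^n) to the weak Morrey space WM^p_q(ℝ^n), uniformly in ε. -/

import Mathlib

noncomputable section

open MeasureTheory Real Set
open scoped ENNReal NNReal

abbrev En (n : ℕ) : Type := EuclideanSpace ℝ (Fin n)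

/-- The Bochner–Riesz kernel of order `δ`: the Fourier transform of `ξ ↦ ((1-|ξ|²)⁺)^δ`. -/
def brKernel (n : ℕ) (δ : ℝ) (x : En n) : ℂ :=
  ∫ ξ : En n, (((max (1 - ‖ξ‖ ^ 2) 0) ^ δ : ℝ) : ℂ) *
    Complex.exp (-(2 * Real.pi) * Complex.I * ((∑ i, x i * ξ i : ℝ) : ℂ))

/-- The dilated kernel `φ_ε(x) = ε^{-n} φ(x/ε)`. -/
def brKernelDil (n : ℕ) (δ ε : ℝ) (x : En n) : ℂ :=
  (ε ^ n)⁻¹ • brKernel n δ (ε⁻¹ • x)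

/-- The Bochner–Riesz means `B^δ_{1/ε} f = f * φ_ε`. -/
def brMeans (n : ℕ) (δ ε : ℝ) (f : En n → ℂ) (x : En n) : ℂ :=
  ∫ y, f y * brKernelDil n δ ε (x - y)

/-- The maximal Bochner–Riesz means `B^δ_* f`. -/
def brMax (n : ℕ) (δ : ℝ) (f : En n → ℂ) (x : En n) : ℝ≥0∞ :=
  ⨆ (ε : ℝ) (_ : 0 < ε), (‖brMeans n δ ε f x‖₊ : ℝ≥0∞)

/-- The radial maximal function `M(f,Φ)(x) = sup_{t>0} |(Φ_t * f)(x)|`. -/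
def radMax (n : ℕ) (Φ : En n → ℂ) (f : En n → ℂ) (x : En n) : ℝ≥0∞ :=
  ⨆ (t : ℝ) (_ : 0 < t), (‖∫ y, (t ^ n)⁻¹ • Φ (t⁻¹ • (x - y)) * f y‖₊ : ℝ≥0∞)

/-- The Morrey quasinorm `‖g‖_{M^p_q}` of a nonnegative function. -/
def morreyQ (n : ℕ) (p q : ℝ) (g : En n → ℝ≥0∞) : ℝ≥0∞ :=
  ⨆ (x : En n) (r : ℝ) (_ : 0 < r),
    (volume (Metric.ball x r)) ^ (1/p - 1/q) *
      (∫⁻ y in Metric.ball x r, g y ^ q) ^ (1/q)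

/-- The weak Morrey quasinorm `‖g‖_{WM^p_q}`. -/
def morreyWQ (n : ℕ) (p q : ℝ) (g : En n → ℝ≥0∞) : ℝ≥0∞ :=
  ⨆ (β : ℝ≥0) (_ : 0 < β),
    (β : ℝ≥0∞) * morreyQ n p q ({x | (β : ℝ≥0∞) < g x}.indicator 1)

/-! ### Part 1: one dimensional oscillatory integral -/

lemma rpow_le_exp_half {a : ℝ} (ha : 0 < a) : ∃ C : ℝ, 0 < C ∧ ∀ y : ℝ, 0 ≤ y →
    (2 + y) ^ a ≤ C * Real.exp (y / 2) := by
  refine ⟨(2 * a) ^ a * Real.exp 1, by positivity, fun y hy => ?_⟩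
  have h1 : (2 + y) / (2 * a) ≤ Real.exp ((2 + y) / (2 * a)) := by
    linarith [Real.add_one_le_exp ((2 + y) / (2 * a))]
  have h2 : ((2 + y) / (2 * a)) ^ a ≤ Real.exp ((2 + y) / (2 * a)) ^ a :=
    Real.rpow_le_rpow (by positivity) h1 ha.le
  rw [← Real.exp_mul, Real.div_rpow (by positivity) (by positivity)] at h2
  have h3 : (2 + y) / (2 * a) * a = 1 + y / 2 := by field_simp
  rw [h3, Real.exp_add, div_le_iff₀ (by positivity)] at h2
  linarith

lemma contAt_cpow {μ : ℝ} (hμ : 0 < μ) (z : ℂ) (hz : 0 ≤ z.re) :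
    ContinuousAt (fun w : ℂ => w ^ (μ : ℂ)) z := by
  by_cases h0 : z = 0
  · subst h0
    have := Complex.continuousAt_cpow_zero_of_re_pos (z := (μ : ℂ)) (by simpa using hμ)
    exact ContinuousAt.comp (f := fun w : ℂ => (w, (μ : ℂ))) (g := fun x : ℂ × ℂ => x.1 ^ x.2)
      this (by fun_prop)
  · have : z ∈ Complex.slitPlane := by
      rw [Complex.mem_slitPlane_iff]
      by_contra hcon
      push Not at hcon
      exact h0 (Complex.ext (by simpa using le_antisymm hcon.1 hz) (by simpa using hcon.2))
    exact (continuousAt_id).cpow continuousAt_const this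

def brF (μ r : ℝ) (z : ℂ) : ℂ :=
  (1 - z) ^ (μ : ℂ) * (1 + z) ^ (μ : ℂ) * Complex.exp (-Complex.I * r * z)

lemma brF_norm (μ r : ℝ) (z : ℂ) :
    ‖brF μ r z‖ = ‖1 - z‖ ^ μ * ‖1 + z‖ ^ μ * Real.exp (r * z.im) := by
  simp [brF, Complex.norm_cpow_real, Complex.norm_exp]

lemma brF_cont {μ : ℝ} (hμ : 0 < μ) (r : ℝ) (z : ℂ) (h1 : -1 ≤ z.re) (h2 : z.re ≤ 1) :
    ContinuousAt (brF μ r) z := by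
  unfold brF
  refine ContinuousAt.mul (ContinuousAt.mul ?_ ?_) (by fun_prop)
  · exact ContinuousAt.comp (f := fun z : ℂ => 1 - z) (g := fun w : ℂ => w ^ (μ : ℂ))
      (contAt_cpow hμ _ (by simp; linarith)) (by fun_prop)
  · exact ContinuousAt.comp (f := fun z : ℂ => 1 + z) (g := fun w : ℂ => w ^ (μ : ℂ))
      (contAt_cpow hμ _ (by simp; linarith)) (by fun_prop)

lemma brF_diff {μ : ℝ} (r : ℝ) (z : ℂ) (h1 : -1 < z.re) (h2 : z.re < 1) :
    DifferentiableAt ℂ (brF μ r) z := by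
  unfold brF
  refine DifferentiableAt.mul (DifferentiableAt.mul ?_ ?_) (by fun_prop)
  · refine DifferentiableAt.cpow (by fun_prop) (by fun_prop) ?_
    rw [Complex.mem_slitPlane_iff]; left; simp; linarith
  · refine DifferentiableAt.cpow (by fun_prop) (by fun_prop) ?_
    rw [Complex.mem_slitPlane_iff]; left; simp; linarith

lemma brF_side {μ : ℝ} (hμ : 0 < μ) : ∃ C : ℝ, 0 < C ∧ ∀ r : ℝ, 1 ≤ r → ∀ T : ℝ, 0 < T →
    ∀ g : ℝ → ℂ, (∀ y ∈ Icc (-T) 0, ‖g y‖ ≤ (-y) ^ μ * (2 + -y) ^ μ * Real.exp (r * y)) →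
    ‖∫ y in (-T)..0, g y‖ ≤ C * r ^ (-(μ + 1)) := by
  obtain ⟨C1, hC1, hC⟩ := rpow_le_exp_half hμ
  refine ⟨C1 * (2 ^ (μ + 1) * Real.Gamma (μ + 1)), mul_pos hC1 (mul_pos (by positivity)
    (Real.Gamma_pos_of_pos (by linarith))), fun r hr T hT g hg => ?_⟩
  have hIntg : IntegrableOn (fun y : ℝ => C1 * (y ^ μ * Real.exp (-(r / 2 * y)))) (Ioi 0) := by
    have := (integrableOn_rpow_mul_exp_neg_mul_rpow (p := 1) (s := μ) (b := r / 2)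
      (by linarith) one_pos (by linarith)).const_mul C1
    refine IntegrableOn.congr_fun this (fun y hy => ?_) measurableSet_Ioi
    simp
  have e1 : ∫ y in (-T)..0, g y = ∫ y in (0 : ℝ)..T, g (-y) := by
    rw [intervalIntegral.integral_comp_neg]; simp
  rw [e1]
  have hsub : IntegrableOn (fun y : ℝ => C1 * (y ^ μ * Real.exp (-(r / 2 * y)))) (Ioc 0 T) :=
    hIntg.mono_set Ioc_subset_Ioi_self
  refine (intervalIntegral.norm_integral_le_of_norm_le
    (g := fun y : ℝ => C1 * (y ^ μ * Real.exp (-(r / 2 * y)))) hT.le ?_ ?_).trans ?_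
  · refine Filter.Eventually.of_forall fun y hy => ?_
    refine (hg (-y) ⟨by linarith [hy.2], by linarith [hy.1]⟩).trans ?_
    rw [neg_neg]
    have h0 := hC y hy.1.le
    have hy' : 0 ≤ y ^ μ := Real.rpow_nonneg hy.1.le _
    calc y ^ μ * (2 + y) ^ μ * Real.exp (r * -y)
        ≤ y ^ μ * (C1 * Real.exp (y / 2)) * Real.exp (r * -y) := by gcongr
      _ = C1 * (y ^ μ * Real.exp (y / 2 + r * -y)) := by rw [Real.exp_add]; ring
      _ ≤ _ := by
        gcongr
        nlinarith [hy.1]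
  · rwa [intervalIntegrable_iff_integrableOn_Ioc_of_le hT.le]
  · rw [intervalIntegral.integral_of_le hT.le]
    refine (setIntegral_mono_set hIntg ?_ ?_).trans ?_
    · filter_upwards [ae_restrict_mem measurableSet_Ioi] with y hy
      have : 0 ≤ y ^ μ := Real.rpow_nonneg (le_of_lt hy) _
      simp only [Pi.zero_apply]; positivity
    · exact Filter.Eventually.of_forall Ioc_subset_Ioi_self
    · rw [integral_const_mul]
      have := Real.integral_rpow_mul_exp_neg_mul_Ioi (a := μ + 1) (r := r / 2) (by linarith)
        (by linarith)
      rw [add_sub_cancel_right] at this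
      rw [this, mul_assoc]
      apply le_of_eq
      have hr0 : 0 < r := by linarith
      rw [Real.rpow_neg hr0.le, one_div_div, Real.div_rpow (by norm_num) hr0.le]
      ring

lemma brF_main {μ : ℝ} (hμ : 0 < μ) : ∃ C : ℝ, 0 < C ∧ ∀ r : ℝ, 1 ≤ r →
    ‖∫ s in (-1 : ℝ)..1, brF μ r s‖ ≤ C * r ^ (-(μ + 1)) := by
  obtain ⟨C, hC, hside⟩ := brF_side hμ
  obtain ⟨C2, hC2, hbot⟩ := rpow_le_exp_half (a := 2 * μ) (by linarith)
  refine ⟨2 * C, by linarith, fun r hr => ?_⟩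
  have key : ∀ T : ℝ, 0 < T →
      ‖∫ s in (-1 : ℝ)..1, brF μ r s‖ ≤ 2 * C2 * Real.exp (-(T / 2)) + 2 * C * r ^ (-(μ + 1)) := by
    intro T hT
    have H := Complex.integral_boundary_rect_eq_zero_of_continuousOn_of_differentiableOn
      (brF μ r) (⟨-1, -T⟩ : ℂ) (⟨1, 0⟩ : ℂ) ?_ ?_
    rotate_left
    · intro z hz
      have := hz.1
      simp only [mem_preimage] at this
      rw [uIcc_of_le (by norm_num)] at this
      exact (brF_cont hμ r z this.1 this.2).continuousWithinAt
    · intro z hz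
      have := hz.1
      simp only [mem_preimage] at this
      rw [min_eq_left (by norm_num), max_eq_right (by norm_num)] at this
      exact (brF_diff r z this.1 this.2).differentiableWithinAt
    simp only [Complex.ofReal_zero, zero_mul, add_zero] at H
    set A := ∫ x : ℝ in (-1 : ℝ)..1, brF μ r (↑x + ↑(-T) * Complex.I)
    set B := ∫ x : ℝ in (-1 : ℝ)..1, brF μ r ↑x
    set D := ∫ y : ℝ in (-T)..0, brF μ r (↑(1 : ℝ) + ↑y * Complex.I) with hD
    set E := ∫ y : ℝ in (-T)..0, brF μ r (↑(-1 : ℝ) + ↑y * Complex.I) with hE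
    have hB : B = A + Complex.I • D - Complex.I • E := by linear_combination -H
    have hA : ‖A‖ ≤ 2 * C2 * Real.exp (-(T / 2)) := by
      refine (intervalIntegral.norm_integral_le_of_norm_le_const
        (C := C2 * Real.exp (-(T / 2))) fun x hx => ?_).trans ?_
      · rw [uIoc_of_le (by norm_num)] at hx
        rw [brF_norm]
        have n1 : ‖1 - ((x : ℂ) + ((-T : ℝ) : ℂ) * Complex.I)‖ ≤ 2 + T := by
          calc ‖1 - ((x : ℂ) + ((-T : ℝ) : ℂ) * Complex.I)‖
              = ‖((1 - x : ℝ) : ℂ) + (T : ℂ) * Complex.I‖ := by congr 1; push_cast; ring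
            _ ≤ ‖((1 - x : ℝ) : ℂ)‖ + ‖(T : ℂ) * Complex.I‖ := norm_add_le _ _
            _ ≤ 2 + T := by
              rw [norm_mul, Complex.norm_I, mul_one, Complex.norm_real, Complex.norm_real,
                Real.norm_eq_abs, Real.norm_eq_abs, abs_of_pos hT, abs_of_nonneg (by linarith [hx.2])]
              linarith [hx.1]
        have n2 : ‖1 + ((x : ℂ) + ((-T : ℝ) : ℂ) * Complex.I)‖ ≤ 2 + T := by
          calc ‖1 + ((x : ℂ) + ((-T : ℝ) : ℂ) * Complex.I)‖
              = ‖((1 + x : ℝ) : ℂ) + ((-T : ℝ) : ℂ) * Complex.I‖ := by congr 1; push_cast; ring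
            _ ≤ ‖((1 + x : ℝ) : ℂ)‖ + ‖((-T : ℝ) : ℂ) * Complex.I‖ := norm_add_le _ _
            _ ≤ 2 + T := by
              rw [norm_mul, Complex.norm_I, mul_one, Complex.norm_real, Complex.norm_real,
                Real.norm_eq_abs, Real.norm_eq_abs, abs_neg, abs_of_pos hT,
                abs_of_nonneg (by linarith [hx.1])]
              linarith [hx.2]
        have him : ((x : ℂ) + ((-T : ℝ) : ℂ) * Complex.I).im = -T := by simp
        rw [him]
        calc _ ≤ (2 + T) ^ μ * (2 + T) ^ μ * Real.exp (r * -T) := by gcongr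
          _ = (2 + T) ^ (2 * μ) * Real.exp (r * -T) := by
            rw [← Real.rpow_add (by linarith)]; ring_nf
          _ ≤ (C2 * Real.exp (T / 2)) * Real.exp (r * -T) := by
            gcongr; exact hbot T hT.le
          _ = C2 * Real.exp (T / 2 + r * -T) := by rw [Real.exp_add]; ring
          _ ≤ C2 * Real.exp (-(T / 2)) := by
            gcongr; nlinarith
      · norm_num; linarith
    have hDn : ‖D‖ ≤ C * r ^ (-(μ + 1)) := by
      refine hside r hr T hT _ fun y hy => ?_
      rw [brF_norm]
      have n1 : ‖1 - (((1 : ℝ) : ℂ) + (y : ℂ) * Complex.I)‖ = -y := by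
        have : 1 - (((1 : ℝ) : ℂ) + (y : ℂ) * Complex.I) = ((-y : ℝ) : ℂ) * Complex.I := by
          push_cast; ring
        rw [this, norm_mul, Complex.norm_I, mul_one, Complex.norm_real, Real.norm_eq_abs,
          abs_of_nonneg (by linarith [hy.2])]
      have n2 : ‖1 + (((1 : ℝ) : ℂ) + (y : ℂ) * Complex.I)‖ ≤ 2 + -y := by
        have : 1 + (((1 : ℝ) : ℂ) + (y : ℂ) * Complex.I) = ((2 : ℝ) : ℂ) + (y : ℂ) * Complex.I := by
          push_cast; ring
        rw [this]
        refine (norm_add_le _ _).trans ?_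
        rw [norm_mul, Complex.norm_I, mul_one, Complex.norm_real, Complex.norm_real,
          Real.norm_eq_abs, Real.norm_eq_abs, abs_of_nonpos hy.2]; norm_num
      have hy0 : 0 ≤ -y := by linarith [hy.2]
      rw [n1]
      have him : (((1 : ℝ) : ℂ) + (y : ℂ) * Complex.I).im = y := by simp
      rw [him]
      gcongr
    have hEn : ‖E‖ ≤ C * r ^ (-(μ + 1)) := by
      refine hside r hr T hT _ fun y hy => ?_
      rw [brF_norm]
      have n1 : ‖1 + (((-1 : ℝ) : ℂ) + (y : ℂ) * Complex.I)‖ = -y := by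
        have : 1 + (((-1 : ℝ) : ℂ) + (y : ℂ) * Complex.I) = ((y : ℝ) : ℂ) * Complex.I := by
          push_cast; ring
        rw [this, norm_mul, Complex.norm_I, mul_one, Complex.norm_real, Real.norm_eq_abs,
          abs_of_nonpos (by linarith [hy.2])]
      have n2 : ‖1 - (((-1 : ℝ) : ℂ) + (y : ℂ) * Complex.I)‖ ≤ 2 + -y := by
        have : 1 - (((-1 : ℝ) : ℂ) + (y : ℂ) * Complex.I)
            = ((2 : ℝ) : ℂ) + ((-y : ℝ) : ℂ) * Complex.I := by
          push_cast; ring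
        rw [this]
        refine (norm_add_le _ _).trans ?_
        rw [norm_mul, Complex.norm_I, mul_one, Complex.norm_real, Complex.norm_real,
          Real.norm_eq_abs, Real.norm_eq_abs, abs_neg, abs_of_nonpos hy.2]; norm_num
      have hy0 : 0 ≤ -y := by linarith [hy.2]
      rw [n1, mul_comm (‖_‖ ^ μ)]
      have him : (((-1 : ℝ) : ℂ) + (y : ℂ) * Complex.I).im = y := by simp
      rw [him]
      gcongr
    rw [hB]
    calc ‖A + Complex.I • D - Complex.I • E‖ ≤ ‖A‖ + ‖Complex.I • D‖ + ‖Complex.I • E‖ :=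
          (norm_sub_le _ _).trans (by gcongr; exact norm_add_le _ _)
      _ = ‖A‖ + ‖D‖ + ‖E‖ := by simp [norm_smul]
      _ ≤ _ := by linarith
  have hlim : Filter.Tendsto (fun T : ℝ => 2 * C2 * Real.exp (-(T / 2)) + 2 * C * r ^ (-(μ + 1)))
      Filter.atTop (nhds (2 * C2 * 0 + 2 * C * r ^ (-(μ + 1)))) := by
    refine Filter.Tendsto.add (Filter.Tendsto.const_mul _ ?_) tendsto_const_nhds
    refine Real.tendsto_exp_neg_atTop_nhds_zero.comp ?_
    exact Filter.tendsto_id.atTop_div_const (by norm_num)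
  rw [mul_zero, zero_add] at hlim
  refine ge_of_tendsto hlim ?_
  filter_upwards [Filter.eventually_gt_atTop 0] with T hT using key T hT

lemma brF_real (μ r s : ℝ) (hs : s ∈ Icc (-1 : ℝ) 1) :
    brF μ r s = (((1 - s ^ 2) ^ μ : ℝ) : ℂ) * Complex.exp (-Complex.I * r * s) := by
  unfold brF
  have h1 : 0 ≤ 1 - s := by linarith [hs.2]
  have h2 : 0 ≤ 1 + s := by linarith [hs.1]
  have : (1 - s ^ 2) = (1 - s) * (1 + s) := by ring
  rw [this, Real.mul_rpow h1 h2]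
  push_cast
  rw [Complex.ofReal_cpow h1, Complex.ofReal_cpow h2]
  push_cast
  ring

/-! ### Part 2: decay of the Bochner–Riesz kernel -/

def brM {n : ℕ} (δ : ℝ) (ξ : En n) : ℝ := (max (1 - ‖ξ‖ ^ 2) 0) ^ δ

lemma brM_cont {n : ℕ} {δ : ℝ} (hδ : 0 < δ) : Continuous (brM δ : En n → ℝ) := by
  unfold brM
  exact Continuous.rpow_const (by fun_prop) (fun _ => Or.inr hδ.le)

lemma brM_zero {n : ℕ} {δ : ℝ} (hδ : 0 < δ) (ξ : En n) (h : 1 ≤ ‖ξ‖) : brM δ ξ = 0 := by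
  unfold brM
  rw [max_eq_right (by nlinarith), Real.zero_rpow hδ.ne']

lemma brM_supp {n : ℕ} {δ : ℝ} (hδ : 0 < δ) : HasCompactSupport (brM δ : En n → ℝ) := by
  refine HasCompactSupport.intro (isCompact_closedBall (0 : En n) 1) fun x hx => ?_
  refine brM_zero hδ x ?_
  simp at hx; exact hx.le

lemma brM_nonneg {n : ℕ} (δ : ℝ) (ξ : En n) : 0 ≤ brM δ ξ :=
  Real.rpow_nonneg (le_max_right _ _) _

lemma brM_integrable {n : ℕ} {δ : ℝ} (hδ : 0 < δ) : Integrable (brM δ : En n → ℝ) :=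
  (brM_cont hδ).integrable_of_hasCompactSupport (brM_supp hδ)

lemma sum_eq_inner {n : ℕ} (x ξ : En n) : (∑ i, x i * ξ i : ℝ) = inner ℝ x ξ := by
  simp [PiLp.inner_apply, mul_comm]

lemma brKernel_eq {n : ℕ} (δ : ℝ) (x : En n) : brKernel n δ x =
    ∫ ξ : En n, (brM δ ξ : ℂ) * Complex.exp (-(2 * Real.pi) * Complex.I * (inner ℝ x ξ : ℝ)) := by
  unfold brKernel brM
  simp_rw [sum_eq_inner]

lemma norm_exp_br (t : ℝ) : ‖Complex.exp (-(2 * Real.pi) * Complex.I * (t : ℂ))‖ = 1 := by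
  rw [Complex.norm_exp]; simp

lemma brKernel_bdd {n : ℕ} {δ : ℝ} (x : En n) :
    ‖brKernel n δ x‖ ≤ ∫ ξ : En n, brM δ ξ := by
  rw [brKernel_eq]
  refine (norm_integral_le_integral_norm _).trans (le_of_eq ?_)
  congr 1; ext ξ
  rw [norm_mul, norm_exp_br, mul_one, Complex.norm_real, Real.norm_of_nonneg (brM_nonneg _ _)]

lemma brKernel_radial {n : ℕ} (δ : ℝ) (x y : En n) (h : ‖x‖ = ‖y‖) :
    brKernel n δ x = brKernel n δ y := by
  rw [brKernel_eq, brKernel_eq]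
  set R := (Submodule.span ℝ {x - y})ᗮ.reflection
  have hR : R x = y := Submodule.reflection_sub h
  symm
  rw [← (R.measurePreserving).integral_comp (R.toHomeomorph.measurableEmbedding)]
  congr 1; ext ξ
  rw [← hR, R.inner_map_map]
  simp [brM]

lemma brInner {m : ℕ} {δ : ℝ} (hδ : 0 < δ) : ∃ c : ℝ, ∀ s : ℝ,
    ∫ η : Fin m → ℝ, (max (1 - s ^ 2 - ∑ i, η i ^ 2) 0) ^ δ
      = c * (max (1 - s ^ 2) 0) ^ (δ + (m : ℝ) / 2) := by
  refine ⟨∫ η : Fin m → ℝ, (max (1 - ∑ i, η i ^ 2) 0) ^ δ, fun s => ?_⟩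
  by_cases hs : 1 - s ^ 2 ≤ 0
  · rw [max_eq_right hs, Real.zero_rpow (by positivity), mul_zero]
    have : ∀ η : Fin m → ℝ, (max (1 - s ^ 2 - ∑ i, η i ^ 2) 0) ^ δ = 0 := by
      intro η
      have : 0 ≤ ∑ i, η i ^ 2 := Finset.sum_nonneg fun i _ => sq_nonneg _
      rw [max_eq_right (by linarith), Real.zero_rpow hδ.ne']
    simp [this]
  · push Not at hs
    set a := √(1 - s ^ 2) with ha
    have ha0 : 0 < a := Real.sqrt_pos.mpr hs
    have ha2 : a ^ 2 = 1 - s ^ 2 := Real.sq_sqrt hs.le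
    have H := Measure.integral_comp_inv_smul_of_nonneg (volume : Measure (Fin m → ℝ))
      (fun η : Fin m → ℝ => (max (1 - ∑ i, η i ^ 2) 0) ^ δ) ha0.le
    rw [max_eq_left hs.le]
    have h2 : ∀ η : Fin m → ℝ, (max (1 - s ^ 2 - ∑ i, η i ^ 2) 0) ^ δ
        = (1 - s ^ 2) ^ δ * (max (1 - ∑ i, (a⁻¹ • η) i ^ 2) 0) ^ δ := by
      intro η
      rw [← Real.mul_rpow hs.le (le_max_right _ _), mul_max_of_nonneg _ _ hs.le, mul_zero]
      congr 2
      have : ∑ i, (a⁻¹ • η) i ^ 2 = (a ^ 2)⁻¹ * ∑ i, η i ^ 2 := by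
        rw [Finset.mul_sum]; congr 1; ext i; simp [mul_pow]
      rw [this, ha2]
      field_simp
    simp_rw [h2]
    rw [integral_const_mul, H, Real.rpow_add hs]
    have : a ^ (Module.finrank ℝ (Fin m → ℝ)) = (1 - s ^ 2) ^ ((m : ℝ) / 2) := by
      simp only [Module.finrank_fintype_fun_eq_card, Fintype.card_fin]
      rw [ha, Real.sqrt_eq_rpow, ← Real.rpow_natCast, ← Real.rpow_mul hs.le]
      congr 1; ring
    rw [this, smul_eq_mul]; ring

def splitEquiv (m : ℕ) : En (m + 1) ≃ᵐ ℝ × (Fin m → ℝ) :=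
  (MeasurableEquiv.toLp 2 (Fin (m + 1) → ℝ)).symm.trans
    (MeasurableEquiv.piFinSuccAbove (fun _ => ℝ) 0)

lemma splitEquiv_mp (m : ℕ) : MeasurePreserving (splitEquiv m) volume volume :=
  (volume_preserving_piFinSuccAbove (fun _ : Fin (m + 1) => ℝ) 0).comp
    (PiLp.volume_preserving_ofLp (Fin (m + 1)))

lemma splitEquiv_fst (m : ℕ) (ξ : En (m + 1)) : (splitEquiv m ξ).1 = ξ 0 := rfl

lemma splitEquiv_snd (m : ℕ) (ξ : En (m + 1)) (i : Fin m) : (splitEquiv m ξ).2 i = ξ i.succ := rfl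

lemma brKernel_axis {m : ℕ} {δ : ℝ} (hδ : 0 < δ) : ∃ c : ℝ, ∀ r : ℝ,
    brKernel (m + 1) δ (r • EuclideanSpace.single 0 1)
      = c * ∫ s in (-1 : ℝ)..1, brF (δ + (m : ℝ) / 2) (2 * Real.pi * r) s := by
  obtain ⟨c, hc⟩ := brInner (m := m) hδ
  refine ⟨c, fun r => ?_⟩
  set g : ℝ × (Fin m → ℝ) → ℂ := fun z => (((max (1 - z.1 ^ 2 - ∑ i, z.2 i ^ 2) 0) ^ δ : ℝ) : ℂ) *
    Complex.exp (-(2 * Real.pi) * Complex.I * ((r * z.1 : ℝ) : ℂ)) with hg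
  have hgi : ∀ ξ : En (m + 1), (brM δ ξ : ℂ) * Complex.exp (-(2 * Real.pi) * Complex.I *
      (inner ℝ (r • EuclideanSpace.single 0 1 : En (m + 1)) ξ : ℝ)) = g (splitEquiv m ξ) := by
    intro ξ
    simp only [hg, splitEquiv_fst, splitEquiv_snd]
    congr 3
    · unfold brM
      congr 2
      rw [EuclideanSpace.norm_sq_eq, Fin.sum_univ_succ]
      simp only [Real.norm_eq_abs, sq_abs]; ring
    · rw [real_inner_smul_left]
      simp [EuclideanSpace.inner_single_left]
  rw [brKernel_eq]
  simp_rw [hgi]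
  have hIntg : Integrable (fun ξ : En (m + 1) => g (splitEquiv m ξ)) := by
    simp_rw [← hgi]
    refine Integrable.mono' (brM_integrable hδ) ?_ ?_
    · have := brM_cont (n := m + 1) hδ
      exact Continuous.aestronglyMeasurable (by fun_prop)
    · refine Filter.Eventually.of_forall fun ξ => ?_
      rw [norm_mul, norm_exp_br, mul_one, Complex.norm_real, Real.norm_of_nonneg (brM_nonneg _ _)]
  rw [(splitEquiv_mp m).integral_comp' g]
  have hIntg' : Integrable g (volume.prod volume) :=
    ((splitEquiv_mp m).integrable_comp_emb (splitEquiv m).measurableEmbedding).1 hIntg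
  rw [Measure.volume_eq_prod, integral_prod _ hIntg']
  have inner_eq : ∀ s : ℝ, ∫ η : Fin m → ℝ, g (s, η) =
      (c : ℂ) * ((((max (1 - s ^ 2) 0) ^ (δ + (m : ℝ) / 2) : ℝ) : ℂ) *
        Complex.exp (-(2 * Real.pi) * Complex.I * ((r * s : ℝ) : ℂ))) := by
    intro s
    simp only [hg]
    rw [integral_mul_const, integral_complex_ofReal, hc s]
    push_cast; ring
  simp_rw [inner_eq]
  rw [integral_const_mul]
  congr 1
  rw [intervalIntegral.integral_of_le (by norm_num), ← integral_indicator measurableSet_Ioc]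
  congr 1; ext s
  by_cases hs : s ∈ Ioc (-1 : ℝ) 1
  · rw [indicator_of_mem hs, brF_real _ _ _ ⟨hs.1.le, hs.2⟩, max_eq_left (by nlinarith [hs.1, hs.2])]
    congr 2; push_cast; ring
  · rw [indicator_of_notMem hs, max_eq_right, Real.zero_rpow (by positivity)]
    · simp
    · simp only [mem_Ioc, not_and_or, not_lt, not_le] at hs
      rcases hs with h | h <;> nlinarith

lemma brKernel_decay {n : ℕ} (hn : 1 ≤ n) {δ : ℝ} (hδ : 0 < δ) : ∃ C : ℝ, 0 < C ∧ ∀ x : En n,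
    ‖brKernel n δ x‖ ≤ C * (1 + ‖x‖) ^ (-(((n : ℝ) + 1) / 2 + δ)) := by
  obtain ⟨m, rfl⟩ : ∃ m, n = m + 1 := ⟨n - 1, by omega⟩
  obtain ⟨c, hc⟩ := brKernel_axis (m := m) hδ
  obtain ⟨C, hC, hF⟩ := brF_main (μ := δ + (m : ℝ) / 2) (by positivity)
  set I0 := ∫ ξ : En (m + 1), brM δ ξ
  have hI0 : 0 ≤ I0 := integral_nonneg fun ξ => brM_nonneg _ _
  set κ := (((m + 1 : ℕ) : ℝ) + 1) / 2 + δ with hκ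
  have hκμ : δ + (m : ℝ) / 2 + 1 = κ := by rw [hκ]; push_cast; ring
  have hκ0 : 0 < κ := by positivity
  refine ⟨2 ^ κ * (I0 + |c| * C + 1), by positivity, fun x => ?_⟩
  have hx0 := norm_nonneg x
  by_cases hx : ‖x‖ ≤ 1
  · refine (brKernel_bdd x).trans ?_
    have : (2 : ℝ) ^ (-κ) ≤ (1 + ‖x‖) ^ (-κ) :=
      Real.rpow_le_rpow_of_nonpos (by positivity) (by linarith) (by linarith)
    have h2 : (2 : ℝ) ^ κ * 2 ^ (-κ) = 1 := by rw [← Real.rpow_add (by norm_num)]; simp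
    calc I0 ≤ (I0 + |c| * C + 1) := by nlinarith [abs_nonneg c, mul_nonneg (abs_nonneg c) hC.le]
      _ = 2 ^ κ * (I0 + |c| * C + 1) * 2 ^ (-κ) := by
        rw [mul_right_comm, h2, one_mul]
      _ ≤ _ := by gcongr
  · push Not at hx
    have hrad : brKernel (m + 1) δ x = brKernel (m + 1) δ (‖x‖ • EuclideanSpace.single 0 1) := by
      apply brKernel_radial
      simp [norm_smul]
    rw [hrad, hc, norm_mul, Complex.norm_real, Real.norm_eq_abs]
    have hpi : 1 ≤ 2 * Real.pi := by linarith [Real.pi_gt_three]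
    have h1 := hF (2 * Real.pi * ‖x‖) (by nlinarith)
    rw [hκμ] at h1
    have h3 : (2 * Real.pi * ‖x‖) ^ (-κ) ≤ ‖x‖ ^ (-κ) :=
      Real.rpow_le_rpow_of_nonpos (by linarith) (by nlinarith) (by linarith)
    have h4 : ‖x‖ ^ (-κ) ≤ ((1 + ‖x‖) / 2) ^ (-κ) :=
      Real.rpow_le_rpow_of_nonpos (by linarith) (by linarith) (by linarith)
    have h5 : ((1 + ‖x‖) / 2) ^ (-κ) = 2 ^ κ * (1 + ‖x‖) ^ (-κ) := by
      rw [Real.div_rpow (by linarith) (by norm_num), Real.rpow_neg (by norm_num : (0 : ℝ) ≤ 2)]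
      field_simp
    have hp : 0 ≤ (1 + ‖x‖) ^ (-κ) := by positivity
    calc _ ≤ |c| * (C * (2 ^ κ * (1 + ‖x‖) ^ (-κ))) := by
          gcongr
          refine h1.trans ?_
          gcongr
          linarith
      _ = 2 ^ κ * (|c| * C) * (1 + ‖x‖) ^ (-κ) := by ring
      _ ≤ _ := by gcongr; linarith

/-! ### Part 3: Schwartz function tools -/

section SchwartzTools
open scoped FourierTransform SchwartzMap ContDiff

abbrev Sch (n : ℕ) : Type := SchwartzMap (En n) ℂ

/-- `x ↦ f (s • x)`. -/
def scS {n : ℕ} (s : ℝ) (hs : 0 < s) (f : Sch n) : Sch n :=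
  SchwartzMap.compCLMOfContinuousLinearEquiv ℂ
    (ContinuousLinearEquiv.smulLeft (Units.mk0 s hs.ne') : En n ≃L[ℝ] En n) f

@[simp] lemma scS_apply {n : ℕ} (s : ℝ) (hs : 0 < s) (f : Sch n) (x : En n) :
    scS s hs f x = f (s • x) := rfl

/-- `x ↦ t^{-n} f (t⁻¹ • x)`. -/
def dilS {n : ℕ} (t : ℝ) (ht : 0 < t) (f : Sch n) : Sch n :=
  ((((t ^ n)⁻¹ : ℝ)) : ℂ) • scS t⁻¹ (inv_pos.2 ht) f

lemma dilS_apply {n : ℕ} (t : ℝ) (ht : 0 < t) (f : Sch n) (x : En n) :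
    dilS t ht f x = (t ^ n)⁻¹ • f (t⁻¹ • x) := by
  simp [dilS]

lemma fourier_dilS {n : ℕ} (t : ℝ) (ht : 0 < t) (f : Sch n) (ξ : En n) :
    𝓕 (dilS t ht f) ξ = 𝓕 f (t • ξ) := by
  rw [SchwartzMap.fourier_coe, SchwartzMap.fourier_coe, Real.fourier_eq, Real.fourier_eq]
  have H := Measure.integral_comp_inv_smul_of_nonneg (volume : Measure (En n))
    (fun v : En n => Real.fourierChar (-inner ℝ v (t • ξ)) • f v) ht.le
  have h2 : ∀ v : En n, Real.fourierChar (-inner ℝ v ξ) • dilS t ht f v =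
      (t ^ n)⁻¹ • (Real.fourierChar (-inner ℝ (t⁻¹ • v) (t • ξ)) • f (t⁻¹ • v)) := by
    intro v
    rw [dilS_apply, real_inner_smul_left, real_inner_smul_right, inv_mul_cancel_left₀ ht.ne',
      smul_comm]
  simp_rw [h2]
  rw [integral_smul, H, smul_smul]
  simp [ht.ne']

def cv {n : ℕ} (g f : Sch n) : Sch n := SchwartzMap.convolution (ContinuousLinearMap.mul ℂ ℂ) g f

lemma cv_apply {n : ℕ} (g f : Sch n) (x : En n) : cv g f x = ∫ y, g (x - y) * f y := by
  unfold cv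
  rw [SchwartzMap.convolution_apply, convolution_eq_swap]
  rfl

lemma fourier_cv {n : ℕ} (g f : Sch n) (ξ : En n) : 𝓕 (cv g f) ξ = 𝓕 g ξ * 𝓕 f ξ := by
  unfold cv
  rw [SchwartzMap.fourier_convolution]
  rfl

lemma sch_ext_fourier {n : ℕ} {f g : Sch n} (h : ∀ ξ, 𝓕 f ξ = 𝓕 g ξ) : f = g := by
  have : 𝓕 f = 𝓕 g := SchwartzMap.ext h
  have h2 := congrArg (fun k => 𝓕⁻ k) this
  simpa using h2

lemma fourier_inv_apply {n : ℕ} (g : Sch n) (ξ : En n) : 𝓕 (𝓕⁻ g) ξ = g ξ := by simp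

/-- Decay weight. -/
def om {n : ℕ} (N : ℕ) (x : En n) : ℝ := ((1 + ‖x‖) ^ N)⁻¹

lemma om_pos {n : ℕ} (N : ℕ) (x : En n) : 0 < om N x := by unfold om; positivity

lemma om_le_one {n : ℕ} (N : ℕ) (x : En n) : om N x ≤ 1 := by
  unfold om
  exact inv_le_one_of_one_le₀ (one_le_pow₀ (by linarith [norm_nonneg x]))

lemma om_zero {n : ℕ} (N : ℕ) : om N (0 : En n) = 1 := by simp [om]

lemma om_add {n : ℕ} (N M : ℕ) (x : En n) : om (N + M) x = om N x * om M x := by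
  simp [om, pow_add, mul_comm]

lemma om_mul_le {n : ℕ} (N : ℕ) (x y z : En n) : om N (x - y) * om N (y - z) ≤ om N (x - z) := by
  unfold om
  rw [← mul_inv, ← mul_pow]
  gcongr
  have h : ‖x - z‖ ≤ ‖x - y‖ + ‖y - z‖ := norm_sub_le_norm_sub_add_norm_sub x y z
  nlinarith [mul_nonneg (norm_nonneg (x - y)) (norm_nonneg (y - z))]

lemma om_cont {n : ℕ} (N : ℕ) : Continuous (om N : En n → ℝ) := by
  unfold om
  refine Continuous.inv₀ (by fun_prop) fun x => ?_
  positivity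

lemma om_integrable {n : ℕ} : Integrable (om (n + 1) : En n → ℝ) := by
  have := integrable_one_add_norm (E := En n) (μ := volume) (r := n + 1) (by simp)
  refine this.congr (Filter.Eventually.of_forall fun x => ?_)
  simp only [om]
  rw [Real.rpow_neg (by positivity), ← Real.rpow_natCast]
  push_cast; rfl

lemma sch_decay {n : ℕ} (g : Sch n) (N : ℕ) : ∃ C : ℝ, 0 < C ∧ ∀ x, ‖g x‖ ≤ C * om N x := by
  set A := 2 ^ N * (Finset.Iic ((N, 0) : ℕ × ℕ)).sup
    (fun m => SchwartzMap.seminorm ℝ (E := En n) (F := ℂ) m.1 m.2) g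
  refine ⟨max A 1, lt_max_of_lt_right one_pos, fun x => ?_⟩
  have h := SchwartzMap.one_add_le_sup_seminorm_apply (𝕜 := ℝ) (m := (N, 0)) (k := N) (n := 0)
    le_rfl le_rfl g x
  rw [norm_iteratedFDeriv_zero] at h
  unfold om
  rw [← div_eq_mul_inv, le_div_iff₀ (by positivity), mul_comm]
  exact h.trans (le_max_left _ _)

lemma cv_enorm_le {n : ℕ} (g f : Sch n) (N : ℕ) (C : ℝ) (hC : ∀ x, ‖g x‖ ≤ C * om N x)
    (x : En n) : ‖cv g f x‖ₑ ≤ ENNReal.ofReal C * ∫⁻ z, ENNReal.ofReal (om N (x - z)) * ‖f z‖ₑ := by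
  rw [cv_apply]
  refine (enorm_integral_le_lintegral_enorm _).trans ?_
  rw [← lintegral_const_mul' _ _ ENNReal.ofReal_ne_top]
  refine lintegral_mono fun z => ?_
  rw [enorm_mul, ← mul_assoc]
  gcongr
  rw [← ofReal_norm_eq_enorm, ← ENNReal.ofReal_mul' (om_pos _ _).le]
  exact ENNReal.ofReal_le_ofReal (hC _)

lemma sch_fourier_inversion {n : ℕ} (g : Sch n) (x : En n) :
    g x = ∫ v : En n, Complex.exp (↑(2 * Real.pi * inner ℝ v x) * Complex.I) • 𝓕 g v := by
  rw [← Real.fourierInv_eq' (𝓕 g : Sch n), ← SchwartzMap.fourierInv_coe]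
  simp

/-- Cutoff equal to one on the ball of radius one, supported in the ball of radius two. -/
def bmp (n : ℕ) : ContDiffBump (0 : En n) := ⟨1, 2, one_pos, by norm_num⟩

def bmp2 (n : ℕ) : ContDiffBump (0 : En n) := ⟨2, 3, two_pos, by norm_num⟩

lemma bmp_one {n : ℕ} {ξ : En n} (h : ‖ξ‖ ≤ 1) : bmp n ξ = 1 :=
  (bmp n).one_of_mem_closedBall (by simpa [bmp] using h)

lemma bmp_zero {n : ℕ} {ξ : En n} (h : 2 ≤ ‖ξ‖) : bmp n ξ = 0 :=
  (bmp n).zero_of_le_dist (by simpa [bmp] using h)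

lemma bmp2_one {n : ℕ} {ξ : En n} (h : ‖ξ‖ ≤ 2) : bmp2 n ξ = 1 :=
  (bmp2 n).one_of_mem_closedBall (by simpa [bmp2] using h)

lemma bmp2_zero {n : ℕ} {ξ : En n} (h : 3 ≤ ‖ξ‖) : bmp2 n ξ = 0 :=
  (bmp2 n).zero_of_le_dist (by simpa [bmp2] using h)

lemma exists_smooth_inv {n : ℕ} (θ : Sch n) (hθ : ∀ ξ, ‖ξ‖ ≤ 3 → θ ξ ≠ 0) :
    ∃ h : En n → ℂ, ContDiff ℝ ∞ h ∧ ∀ ξ, ‖ξ‖ ≤ 2 → h ξ * θ ξ = 1 := by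
  have hθs : ContDiff ℝ ∞ θ := θ.smooth ⊤
  have hden : ∀ ξ, 0 < ‖θ ξ‖ ^ 2 + (1 - bmp2 n ξ) := by
    intro ξ
    have h1 := (bmp2 n).le_one (x := ξ)
    by_cases hξ : ‖ξ‖ ≤ 3
    · have := norm_pos_iff.2 (hθ ξ hξ)
      have : 0 < ‖θ ξ‖ ^ 2 := by positivity
      linarith
    · rw [bmp2_zero (by linarith)]
      positivity
  refine ⟨fun ξ => (starRingEnd ℂ) (θ ξ) * (((‖θ ξ‖ ^ 2 + (1 - bmp2 n ξ))⁻¹ : ℝ) : ℂ), ?_, ?_⟩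
  · refine ContDiff.mul ?_ ?_
    · exact Complex.conjCLE.contDiff.comp hθs
    · refine Complex.ofRealCLM.contDiff.comp ?_
      refine ContDiff.inv ?_ fun ξ => (hden ξ).ne'
      exact (hθs.norm_sq ℝ).add (contDiff_const.sub (bmp2 n).contDiff)
  · intro ξ hξ
    have h0 : (‖θ ξ‖ : ℂ) ^ 2 ≠ 0 := by
      have := norm_ne_zero_iff.2 (hθ ξ (by linarith))
      exact_mod_cast pow_ne_zero 2 this
    simp only [bmp2_one hξ]
    rw [mul_right_comm, ← Complex.normSq_eq_conj_mul_self, Complex.normSq_eq_norm_sq]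
    push_cast
    rw [sub_self, add_zero, mul_inv_cancel₀ h0]

end SchwartzTools

/-! ### Part 4: reproducing formula -/

section Repro
open scoped FourierTransform SchwartzMap ContDiff

/-- A compactly supported smooth function as a Schwartz function. -/
lemma exists_sch {n : ℕ} (g : En n → ℂ) (h1 : ContDiff ℝ ∞ g) (h2 : ∀ ξ, 2 ≤ ‖ξ‖ → g ξ = 0) :
    ∃ G : Sch n, ∀ ξ, G ξ = g ξ := by
  have hc : HasCompactSupport g := by
    refine HasCompactSupport.of_support_subset_isCompact (isCompact_closedBall (0 : En n) 2) ?_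
    intro ξ hξ
    by_contra hh
    rw [Metric.mem_closedBall, dist_zero_right, not_le] at hh
    exact hξ (h2 ξ hh.le)
  exact ⟨hc.toSchwartzMap h1, fun ξ => rfl⟩

lemma exists_pow_mul {n : ℕ} (θ : Sch n) (L : ℕ) :
    ∃ G : Sch n, ∀ ξ, G ξ = ((‖ξ‖ ^ (2 * L) : ℝ) : ℂ) * θ ξ := by
  induction L with
  | zero => exact ⟨θ, by simp⟩
  | succ L ih =>
    obtain ⟨G, hG⟩ := ih
    have ht : Function.HasTemperateGrowth (fun ξ : En n => ‖ξ‖ ^ 2) :=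
      Function.hasTemperateGrowth_norm_sq _
    refine ⟨SchwartzMap.smulLeftCLM ℂ (fun ξ : En n => ‖ξ‖ ^ 2) G, fun ξ => ?_⟩
    rw [SchwartzMap.smulLeftCLM_apply_apply ht, hG]
    simp only [Complex.real_smul]
    push_cast
    ring

lemma bmp_smul_contDiff {n : ℕ} (c : ℝ) : ContDiff ℝ ∞ (fun ξ : En n => bmp n (c • ξ)) :=
  (bmp n).contDiff.comp (contDiff_const_smul c)

set_option maxHeartbeats 2000000 in
lemma exists_kernels {n : ℕ} (Φ : Sch n) (hΦ : ∀ ξ, ‖ξ‖ ≤ 3 → 𝓕 Φ ξ ≠ 0) (L N : ℕ) :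
    ∃ (K : ℕ → Sch n) (C : ℝ), 0 < C ∧
      (∀ k y, ‖K k y‖ ≤ C * (2⁻¹ : ℝ) ^ (k * L) * om N y) ∧
      (∀ J ξ, ∑ k ∈ Finset.range (J + 1), 𝓕 (K k) ξ * 𝓕 Φ ((2⁻¹ : ℝ) ^ k • ξ) =
        𝓕 Φ ξ * (bmp n ((2⁻¹ : ℝ) ^ J • ξ) : ℂ)) := by
  obtain ⟨h, hs, hinv⟩ := exists_smooth_inv (𝓕 Φ) hΦ
  obtain ⟨Ξh, hΞh⟩ := exists_pow_mul (𝓕 Φ) (L + n)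
  obtain ⟨B, hB⟩ := exists_sch (fun ξ : En n => (bmp n ξ : ℂ))
    (Complex.ofRealCLM.contDiff.comp (bmp n).contDiff)
    (fun ξ hξ => by simp [bmp_zero hξ])
  have hden : ∀ ξ : En n, 0 < ‖ξ‖ ^ (2 * (L + n)) + bmp n ((4 : ℝ) • ξ) := by
    intro ξ
    by_cases h0 : ξ = 0
    · subst h0
      have : bmp n ((4 : ℝ) • (0 : En n)) = 1 := bmp_one (by simp)
      rw [this]; positivity
    · have : 0 < ‖ξ‖ := norm_pos_iff.2 h0
      have h3 : 0 ≤ bmp n ((4 : ℝ) • ξ) := (bmp n).nonneg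
      positivity
  obtain ⟨Lh, hLh⟩ := exists_sch (fun ξ : En n =>
      (((bmp n ξ - bmp n ((2 : ℝ) • ξ)) * (‖ξ‖ ^ (2 * (L + n)) + bmp n ((4 : ℝ) • ξ))⁻¹ : ℝ) : ℂ)
        * h ξ) (by
      refine ContDiff.mul ?_ hs
      refine Complex.ofRealCLM.contDiff.comp ?_
      refine ContDiff.mul ?_ ?_
      · exact (bmp n).contDiff.sub (bmp_smul_contDiff 2)
      · refine ContDiff.inv ?_ fun ξ => (hden ξ).ne'
        refine ContDiff.add ?_ (bmp_smul_contDiff 4)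
        simp_rw [pow_mul]
        exact (contDiff_norm_sq ℝ).pow _) (by
      intro ξ hξ
      have h2 : bmp n ((2 : ℝ) • ξ) = 0 := bmp_zero (by rw [norm_smul]; norm_num; linarith)
      simp [bmp_zero hξ, h2])
  obtain ⟨Ξ, hΞ⟩ : ∃ Ξ : Sch n, Ξ = 𝓕⁻ Ξh := ⟨_, rfl⟩
  obtain ⟨Λ, hΛ⟩ : ∃ Λ : Sch n, Λ = 𝓕⁻ Lh := ⟨_, rfl⟩
  obtain ⟨C1, hC1, hd1⟩ := sch_decay Ξ N
  obtain ⟨C2, hC2, hd2⟩ := sch_decay Λ (N + (n + 1))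
  obtain ⟨C3, hC3, hd3⟩ := sch_decay (𝓕⁻ B : Sch n) N
  have h2k : ∀ k : ℕ, (0 : ℝ) < (2⁻¹ : ℝ) ^ k := fun k => by positivity
  obtain ⟨K, hK⟩ : ∃ K : ℕ → Sch n, K = fun k => if k = 0 then 𝓕⁻ B else
    ((((2⁻¹ : ℝ) ^ (k * (2 * (L + n))) : ℝ)) : ℂ) • cv Ξ (dilS ((2⁻¹ : ℝ) ^ k) (h2k k) Λ) :=
    ⟨_, rfl⟩
  obtain ⟨I0, hI0⟩ : ∃ I0 : ℝ, I0 = ∫ w : En n, om (n + 1) w := ⟨_, rfl⟩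
  have hI0n : 0 ≤ I0 := by rw [hI0]; exact integral_nonneg fun w => (om_pos _ _).le
  refine ⟨K, C1 * C2 * I0 + C3, by positivity, ?_, ?_⟩
  · intro k y
    by_cases hk : k = 0
    · subst hk
      simp only [hK, if_true, zero_mul, pow_zero, mul_one]
      refine (hd3 y).trans ?_
      have := om_pos N y
      gcongr
      have : 0 ≤ C1 * C2 * I0 := by positivity
      linarith
    · simp only [hK, if_neg hk]
      have hcv : ‖cv Ξ (dilS ((2⁻¹ : ℝ) ^ k) (h2k k) Λ) y‖ ≤
          C1 * C2 * I0 * 2 ^ (k * n) * om N y := by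
        rw [cv_apply]
        have : C1 * C2 * I0 * 2 ^ (k * n) * om N y =
            ∫ w : En n, C1 * C2 * 2 ^ (k * n) * om N y * om (n + 1) w := by
          rw [integral_const_mul, ← hI0]; ring
        rw [this]
        refine norm_integral_le_of_norm_le (om_integrable.const_mul _)
          (Filter.Eventually.of_forall fun w => ?_)
        rw [norm_mul, dilS_apply, norm_smul, norm_inv, norm_pow, norm_pow, norm_inv]
        have e1 := hd1 (y - w)
        have e2 := hd2 (((2⁻¹ : ℝ) ^ k)⁻¹ • w)
        have e3 : om (N + (n + 1)) (((2⁻¹ : ℝ) ^ k)⁻¹ • w) ≤ om N w * om (n + 1) w := by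
          rw [← om_add]
          unfold om
          gcongr
          rw [norm_smul, inv_pow, inv_inv, norm_pow, Real.norm_ofNat]
          exact le_mul_of_one_le_left (norm_nonneg _) (one_le_pow₀ (by norm_num))
        have e4 := om_mul_le N y w 0
        simp only [sub_zero] at e4
        have e5 : (((‖(2 : ℝ)‖⁻¹) ^ k) ^ n)⁻¹ = 2 ^ (k * n) := by
          rw [Real.norm_ofNat, ← pow_mul, inv_pow, inv_inv]
        rw [e5]
        have p1 := om_pos N (y - w)
        have p2 := om_pos (n + 1) w
        calc ‖Ξ (y - w)‖ * (2 ^ (k * n) * ‖Λ (((2⁻¹ : ℝ) ^ k)⁻¹ • w)‖)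
            ≤ (C1 * om N (y - w)) * (2 ^ (k * n) * (C2 * (om N w * om (n + 1) w))) := by
              gcongr
              exact e2.trans (by gcongr)
          _ = C1 * C2 * 2 ^ (k * n) * (om N (y - w) * om N w) * om (n + 1) w := by ring
          _ ≤ _ := by gcongr
      rw [smul_apply, norm_smul, Complex.norm_real, norm_pow, norm_inv, Real.norm_ofNat]
      have p1 := om_pos N y
      calc (2⁻¹ : ℝ) ^ (k * (2 * (L + n))) * ‖cv Ξ (dilS ((2⁻¹ : ℝ) ^ k) (h2k k) Λ) y‖
          ≤ (2⁻¹ : ℝ) ^ (k * (2 * (L + n))) * (C1 * C2 * I0 * 2 ^ (k * n) * om N y) := by gcongr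
        _ = C1 * C2 * I0 * ((2⁻¹ : ℝ) ^ (k * (2 * (L + n))) * 2 ^ (k * n)) * om N y := by ring
        _ ≤ (C1 * C2 * I0 + C3) * (2⁻¹ : ℝ) ^ (k * L) * om N y := by
          have e6 : (2⁻¹ : ℝ) ^ (k * (2 * (L + n))) * 2 ^ (k * n) =
              (2⁻¹ : ℝ) ^ (k * L + k * (L + n)) := by
            have : k * (2 * (L + n)) = k * L + k * (L + n) + k * n := by ring
            rw [this, pow_add, mul_assoc, ← mul_pow]; norm_num
          rw [e6]
          have e7 : (2⁻¹ : ℝ) ^ (k * L + k * (L + n)) ≤ (2⁻¹ : ℝ) ^ (k * L) :=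
            pow_le_pow_of_le_one (by norm_num) (by norm_num) (by omega)
          have e8 : C1 * C2 * I0 ≤ C1 * C2 * I0 + C3 := by linarith
          gcongr
  · intro J ξ
    have hterm : ∀ k : ℕ, 𝓕 (K (k + 1)) ξ * 𝓕 Φ ((2⁻¹ : ℝ) ^ (k + 1) • ξ) =
        𝓕 Φ ξ * ((bmp n ((2⁻¹ : ℝ) ^ (k + 1) • ξ) : ℂ) - (bmp n ((2⁻¹ : ℝ) ^ k • ξ) : ℂ)) := by
      intro k
      simp only [hK, Nat.add_eq_zero_iff, one_ne_zero, and_false, if_false]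
      rw [FourierTransform.fourier_smul, smul_apply, fourier_cv, fourier_dilS, hΞ, hΛ,
        fourier_inv_apply, fourier_inv_apply, hΞh, hLh, smul_eq_mul]
      set η : En n := (2⁻¹ : ℝ) ^ (k + 1) • ξ with hη
      have hη2 : (2⁻¹ : ℝ) ^ k • ξ = (2 : ℝ) • η := by
        rw [hη, smul_smul, pow_succ]; congr 1; ring
      rw [hη2]
      by_cases c1 : 2 ≤ ‖η‖
      · have h2 : bmp n ((2 : ℝ) • η) = 0 := bmp_zero (by rw [norm_smul]; norm_num; linarith)
        simp [bmp_zero c1, h2]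
      by_cases c2 : ‖η‖ ≤ 1 / 2
      · have h2 : bmp n ((2 : ℝ) • η) = 1 := bmp_one (by rw [norm_smul]; norm_num; linarith)
        have h3 : bmp n η = 1 := bmp_one (by linarith)
        simp [h2, h3]
      push Not at c1 c2
      have h4 : bmp n ((4 : ℝ) • η) = 0 := bmp_zero (by rw [norm_smul]; norm_num; linarith)
      have h5 := hinv η c1.le
      rw [h4, add_zero]
      have h6 : ‖ξ‖ = 2 ^ (k + 1) * ‖η‖ := by
        rw [hη, norm_smul, norm_pow, norm_inv, Real.norm_ofNat, ← mul_assoc, ← mul_pow]; norm_num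
      have h7 : (‖η‖ : ℂ) ≠ 0 := by
        have : ‖η‖ ≠ 0 := by linarith
        exact_mod_cast this
      rw [h6]
      push_cast
      rw [mul_pow, ← pow_mul, inv_pow]
      have h8 : (2 : ℂ) ^ ((k + 1) * (2 * (L + n))) ≠ 0 := pow_ne_zero _ two_ne_zero
      calc _ = ((2 : ℂ) ^ ((k + 1) * (2 * (L + n))))⁻¹ * (2 : ℂ) ^ ((k + 1) * (2 * (L + n)))
            * ((‖η‖ : ℂ) ^ (2 * (L + n)) * ((‖η‖ : ℂ) ^ (2 * (L + n)))⁻¹) *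
            (𝓕 Φ ξ * ((bmp n η : ℂ) - (bmp n ((2 : ℝ) • η) : ℂ))) * (h η * 𝓕 Φ η) := by ring
        _ = _ := by
          rw [h5, inv_mul_cancel₀ h8, mul_inv_cancel₀ (pow_ne_zero _ h7)]; ring
    induction J with
    | zero =>
      simp only [zero_add, Finset.range_one, Finset.sum_singleton, pow_zero, one_smul]
      simp only [hK, if_true]
      rw [fourier_inv_apply, hB, mul_comm]
    | succ J ih =>
      rw [Finset.sum_range_succ, ih, hterm]
      ring

end Repro

/-! ### Part 5: base estimate and its scaled version -/

section BaseEst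
open scoped FourierTransform SchwartzMap ContDiff

lemma half_pow_pos (k : ℕ) : (0 : ℝ) < (2⁻¹ : ℝ) ^ k := by positivity

/-- `v_j f = Φ_{2^{-j}} * f`. -/
def vv {n : ℕ} (Φ f : Sch n) (j : ℕ) : Sch n := cv (dilS ((2⁻¹ : ℝ) ^ j) (half_pow_pos j) Φ) f

lemma fourier_vv {n : ℕ} (Φ f : Sch n) (j : ℕ) (ξ : En n) :
    𝓕 (vv Φ f j) ξ = 𝓕 Φ ((2⁻¹ : ℝ) ^ j • ξ) * 𝓕 f ξ := by
  unfold vv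
  rw [fourier_cv, fourier_dilS]

lemma base_est {n : ℕ} (Φ : Sch n) (hΦ : ∀ ξ, ‖ξ‖ ≤ 3 → 𝓕 Φ ξ ≠ 0) (L N : ℕ) :
    ∃ C : ℝ, 0 < C ∧ ∀ (f : Sch n) (y : En n), ‖vv Φ f 0 y‖ₑ ≤
      ENNReal.ofReal C * ∑' k : ℕ, (2⁻¹ : ℝ≥0∞) ^ (k * L) *
        ∫⁻ z, ENNReal.ofReal (om N (y - z)) * ‖vv Φ f k z‖ₑ := by
  obtain ⟨K, C, hC, hK, hsum⟩ := exists_kernels Φ hΦ L N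
  refine ⟨C, hC, fun f y => ?_⟩
  obtain ⟨S, hS⟩ : ∃ S : ℕ → Sch n, S = fun J => ∑ k ∈ Finset.range (J + 1), cv (K k) (vv Φ f k) :=
    ⟨_, rfl⟩
  have hSF : ∀ J ξ, 𝓕 (S J) ξ = (bmp n ((2⁻¹ : ℝ) ^ J • ξ) : ℂ) * 𝓕 (vv Φ f 0) ξ := by
    intro J ξ
    have e1 : 𝓕 (S J) = ∑ k ∈ Finset.range (J + 1), 𝓕 (cv (K k) (vv Φ f k)) := by
      rw [hS]
      exact map_sum (SchwartzMap.fourierTransformCLM ℂ) _ _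
    rw [e1, sum_apply]
    simp_rw [fourier_cv, fourier_vv]
    simp only [pow_zero, one_smul]
    rw [← mul_assoc, mul_comm (bmp n _ : ℂ), ← hsum, Finset.sum_mul]
    refine Finset.sum_congr rfl fun k _ => by ring
  have hbound : ∀ J, ‖S J y‖ₑ ≤ ENNReal.ofReal C * ∑' k : ℕ, (2⁻¹ : ℝ≥0∞) ^ (k * L) *
        ∫⁻ z, ENNReal.ofReal (om N (y - z)) * ‖vv Φ f k z‖ₑ := by
    intro J
    rw [hS]
    simp only [sum_apply]
    refine (enorm_sum_le _ _).trans ?_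
    rw [← ENNReal.tsum_mul_left]
    refine le_trans ?_ (ENNReal.sum_le_tsum (Finset.range (J + 1)))
    refine Finset.sum_le_sum fun k _ => ?_
    refine (cv_enorm_le (K k) (vv Φ f k) N _ (hK k) y).trans (le_of_eq ?_)
    rw [ENNReal.ofReal_mul hC.le, ENNReal.ofReal_pow (by norm_num),
      ENNReal.ofReal_inv_of_pos (by norm_num), ENNReal.ofReal_ofNat, mul_assoc]
  have hlim : Filter.Tendsto (fun J => S J y) Filter.atTop (nhds (vv Φ f 0 y)) := by
    rw [sch_fourier_inversion (vv Φ f 0) y]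
    have e2 : ∀ J, S J y = _ := fun J => sch_fourier_inversion (S J) y
    simp_rw [e2]
    refine tendsto_integral_of_dominated_convergence (fun v => ‖𝓕 (vv Φ f 0) v‖) ?_
      (SchwartzMap.integrable (𝓕 (vv Φ f 0))).norm ?_ ?_
    · intro J
      refine Continuous.aestronglyMeasurable ?_
      have := (𝓕 (S J)).continuous
      fun_prop
    · intro J
      refine Filter.Eventually.of_forall fun v => ?_
      rw [norm_smul, Complex.norm_exp_ofReal_mul_I, one_mul, hSF, norm_mul, Complex.norm_real,
        Real.norm_of_nonneg (bmp n).nonneg]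
      exact mul_le_of_le_one_left (norm_nonneg _) (bmp n).le_one
    · refine Filter.Eventually.of_forall fun v => ?_
      refine Filter.Tendsto.const_smul ?_ _
      have h0 : Filter.Tendsto (fun J : ℕ => (2⁻¹ : ℝ) ^ J • v) Filter.atTop (nhds ((0 : ℝ) • v)) :=
        (tendsto_pow_atTop_nhds_zero_of_lt_one (by norm_num) (by norm_num)).smul_const v
      have h1 : ∀ᶠ J : ℕ in Filter.atTop, ‖(2⁻¹ : ℝ) ^ J • v‖ < 1 := by
        have := h0.norm
        rw [zero_smul, norm_zero] at this
        exact this.eventually (gt_mem_nhds one_pos)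
      refine tendsto_const_nhds.congr' ?_
      filter_upwards [h1] with J hJ
      rw [hSF, bmp_one hJ.le]; simp
  exact le_of_tendsto hlim.enorm (Filter.Eventually.of_forall hbound)

lemma cv_dil_scS {n : ℕ} (Φ f : Sch n) (t s : ℝ) (ht : 0 < t) (hs : 0 < s) (x : En n) :
    cv (dilS t ht Φ) (scS s hs f) x = cv (dilS (t * s) (mul_pos ht hs) Φ) f (s • x) := by
  rw [cv_apply, cv_apply]
  have H := Measure.integral_comp_smul_of_nonneg (volume : Measure (En n))
    (fun y : En n => dilS (t * s) (mul_pos ht hs) Φ (s • x - y) * f y) s (hR := hs.le)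
  have e : ∀ y : En n, dilS t ht Φ (x - y) * scS s hs f y =
      s ^ n • (dilS (t * s) (mul_pos ht hs) Φ (s • x - s • y) * f (s • y)) := by
    intro y
    rw [dilS_apply, dilS_apply, scS_apply, ← smul_sub, smul_smul]
    have : (t * s)⁻¹ * s = t⁻¹ := by field_simp
    rw [this, mul_pow, mul_inv, smul_mul_assoc, smul_mul_assoc, smul_smul]
    congr 1
    field_simp
  simp_rw [e]
  rw [integral_smul, H, smul_smul]
  simp [hs.ne']

lemma lintegral_smul_subst {n : ℕ} (s : ℝ) (hs : 0 < s) (F : En n → ℝ≥0∞) :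
    ∫⁻ z, F (s • z) = ENNReal.ofReal ((s ^ n)⁻¹) * ∫⁻ z, F z := by
  have h := Measure.map_addHaar_smul (volume : Measure (En n)) hs.ne'
  have e : ∫⁻ z, F z ∂(Measure.map (fun z : En n => s • z) volume) = ∫⁻ z, F (s • z) :=
    lintegral_map_equiv F (Homeomorph.smulOfNeZero s hs.ne').toMeasurableEquiv
  rw [← e, h, lintegral_smul_measure]
  simp [abs_of_pos hs]

lemma base_est_scaled {n : ℕ} (Φ : Sch n) (hΦ : ∀ ξ, ‖ξ‖ ≤ 3 → 𝓕 Φ ξ ≠ 0) (L N : ℕ) :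
    ∃ C : ℝ, 0 < C ∧ ∀ (f : Sch n) (j : ℕ) (y : En n), ‖vv Φ f j y‖ₑ ≤
      ENNReal.ofReal C * ∑' k : ℕ, (2⁻¹ : ℝ≥0∞) ^ (k * L) * ((2 : ℝ≥0∞) ^ (j * n) *
        ∫⁻ z, ENNReal.ofReal (om N (y - z)) * ‖vv Φ f (j + k) z‖ₑ) := by
  obtain ⟨C, hC, H⟩ := base_est Φ hΦ L N
  refine ⟨C, hC, fun f j y => ?_⟩
  have hsc : ∀ k z, vv Φ (scS ((2⁻¹ : ℝ) ^ j) (half_pow_pos j) f) k z =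
      vv Φ f (j + k) ((2⁻¹ : ℝ) ^ j • z) := by
    intro k z
    unfold vv
    rw [cv_dil_scS]
    congr! 3
    rw [pow_add, mul_comm]
  have h1 := H (scS ((2⁻¹ : ℝ) ^ j) (half_pow_pos j) f) ((2 : ℝ) ^ j • y)
  have e0 : (2⁻¹ : ℝ) ^ j * 2 ^ j = 1 := by rw [← mul_pow]; norm_num
  simp_rw [hsc] at h1
  rw [add_zero, smul_smul, e0, one_smul] at h1
  refine h1.trans ?_
  gcongr with k
  have e1 : ∀ z : En n, om N ((2 : ℝ) ^ j • y - z) ≤ om N (y - (2⁻¹ : ℝ) ^ j • z) := by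
    intro z
    have : (2 : ℝ) ^ j • y - z = (2 : ℝ) ^ j • (y - (2⁻¹ : ℝ) ^ j • z) := by
      rw [smul_sub, smul_smul, mul_comm, e0, one_smul]
    rw [this]
    unfold om
    gcongr
    rw [norm_smul, norm_pow, Real.norm_ofNat]
    exact le_mul_of_one_le_left (norm_nonneg _) (one_le_pow₀ (by norm_num))
  calc ∫⁻ z, ENNReal.ofReal (om N ((2 : ℝ) ^ j • y - z)) * ‖vv Φ f (j + k) ((2⁻¹ : ℝ) ^ j • z)‖ₑ
      ≤ ∫⁻ z, ENNReal.ofReal (om N (y - (2⁻¹ : ℝ) ^ j • z)) *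
          ‖vv Φ f (j + k) ((2⁻¹ : ℝ) ^ j • z)‖ₑ := by
        gcongr with z
        exact e1 z
    _ = _ := by
      rw [lintegral_smul_subst _ (half_pow_pos j)
        (fun z => ENNReal.ofReal (om N (y - z)) * ‖vv Φ f (j + k) z‖ₑ)]
      congr 1
      rw [← pow_mul, inv_pow, inv_inv, ENNReal.ofReal_pow (by norm_num), ENNReal.ofReal_ofNat]

end BaseEst

/-! ### Part 6: the Fefferman-Stein type pointwise estimate -/

section FS
open scoped FourierTransform SchwartzMap ContDiff

lemma self_bound (M D : ℝ≥0∞) (q : ℝ) (hq0 : 0 < q) (hM : M ≠ ⊤)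
    (h : M ≤ D * M ^ (1 - q)) : M ^ q ≤ D := by
  by_cases h0 : M = 0
  · rw [h0, ENNReal.zero_rpow_of_pos hq0]; exact bot_le
  have h1 : M ^ q * M ^ (1 - q) = M := by
    rw [← ENNReal.rpow_add _ _ h0 hM]; simp
  have h2 : M ^ (1 - q) ≠ 0 := by
    simp [ENNReal.rpow_eq_zero_iff, h0, hM]
  have h3 : M ^ (1 - q) ≠ ⊤ := by
    simp [ENNReal.rpow_eq_top_iff, h0, hM]
  have h4 : M ^ q * M ^ (1 - q) ≤ D * M ^ (1 - q) := by rw [h1]; exact h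
  exact (ENNReal.mul_le_mul_iff_left h2 h3).1 h4

lemma m_lemma {n : ℕ} (V : ℕ → En n → ℝ≥0∞) (G : En n → ℝ≥0∞) (B : ℝ≥0∞) (hB : B ≠ ⊤)
    (hVB : ∀ j y, V j y ≤ B) (hVG : ∀ j y, V j y ≤ G y)
    (L N : ℕ) (q : ℝ) (hq0 : 0 < q) (hq1 : q ≤ 1) (hL : (n : ℝ) + 1 ≤ L * q) (C : ℝ≥0∞)
    (hV : ∀ j y, V j y ≤ C * ∑' k : ℕ, (2⁻¹ : ℝ≥0∞) ^ (k * L) * ((2 : ℝ≥0∞) ^ (j * n) *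
        ∫⁻ z, ENNReal.ofReal (om N (y - z)) * V (j + k) z)) (x y : En n) :
    (ENNReal.ofReal (om N (x - y)) * V 0 y) ^ q ≤
      2 * C * ∫⁻ z, ENNReal.ofReal (om N (x - z)) ^ q * G z ^ q := by
  obtain ⟨Q, hQ⟩ : ∃ Q : ℝ≥0∞, Q = ∫⁻ z, ENNReal.ofReal (om N (x - z)) ^ q * G z ^ q := ⟨_, rfl⟩
  obtain ⟨W, hW⟩ : ∃ W : ℕ → En n → ℝ≥0∞, W = fun j y =>
    (2⁻¹ : ℝ≥0∞) ^ (j * L) * (ENNReal.ofReal (om N (x - y)) * V j y) := ⟨_, rfl⟩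
  obtain ⟨M, hM⟩ : ∃ M : ℝ≥0∞, M = ⨆ j, ⨆ y, W j y := ⟨_, rfl⟩
  have hhalf : (2⁻¹ : ℝ≥0∞) ≤ 1 := by simp
  have hom : ∀ z : En n, ENNReal.ofReal (om N z) ≤ 1 := fun z => by
    simpa using ENNReal.ofReal_le_ofReal (om_le_one N z)
  have hWM : ∀ j y, W j y ≤ M := fun j y => by
    rw [hM]; exact le_iSup₂_of_le j y le_rfl
  have hMB : M ≤ B := by
    rw [hM]
    refine iSup₂_le fun j y => ?_
    rw [hW]
    calc (2⁻¹ : ℝ≥0∞) ^ (j * L) * (ENNReal.ofReal (om N (x - y)) * V j y) ≤ 1 * (1 * B) := by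
          gcongr
          · exact pow_le_one₀ (by simp) hhalf
          · exact hom _
          · exact hVB j y
      _ = B := by simp
  have hMt : M ≠ ⊤ := ne_top_of_le_ne_top hB hMB
  have hWq : ∀ j, ∫⁻ z, W j z ≤ (2⁻¹ : ℝ≥0∞) ^ (j * (n + 1)) * (Q * M ^ (1 - q)) := by
    intro j
    have : ∀ z, W j z ≤ (2⁻¹ : ℝ≥0∞) ^ (j * (n + 1)) * M ^ (1 - q) *
        (ENNReal.ofReal (om N (x - z)) ^ q * G z ^ q) := by
      intro z
      calc W j z = W j z ^ q * W j z ^ (1 - q) := by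
            rw [← ENNReal.rpow_add_of_nonneg _ _ hq0.le (by linarith)]; simp
        _ ≤ ((2⁻¹ : ℝ≥0∞) ^ (j * (n + 1)) * (ENNReal.ofReal (om N (x - z)) ^ q * G z ^ q)) *
            M ^ (1 - q) := by
          have e1 : W j z ^ (1 - q) ≤ M ^ (1 - q) :=
            ENNReal.rpow_le_rpow (hWM j z) (by linarith)
          refine mul_le_mul' ?_ e1
          rw [hW]
          simp only
          rw [ENNReal.mul_rpow_of_nonneg _ _ hq0.le, ENNReal.mul_rpow_of_nonneg _ _ hq0.le]
          gcongr ?_ * (_ * ?_ ^ _)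
          · rw [← ENNReal.rpow_natCast, ← ENNReal.rpow_natCast, ← ENNReal.rpow_mul]
            refine ENNReal.rpow_le_rpow_of_exponent_ge hhalf ?_
            push_cast
            have : (0 : ℝ) ≤ j := by positivity
            nlinarith
          · exact hVG j z
        _ = _ := by ring
    refine (lintegral_mono this).trans (le_of_eq ?_)
    rw [lintegral_const_mul', hQ]
    · ring
    · refine ENNReal.mul_ne_top (ENNReal.pow_ne_top (by simp)) ?_
      exact ENNReal.rpow_ne_top_of_nonneg (by linarith) hMt
  have hgeo : ∑' k : ℕ, (2⁻¹ : ℝ≥0∞) ^ k = 2 := by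
    rw [ENNReal.tsum_geometric, ENNReal.one_sub_inv_two, inv_inv]
  have h2 : ∀ m : ℕ, (2⁻¹ : ℝ≥0∞) ^ m * 2 ^ m = 1 := fun m => by
    rw [← mul_pow, ENNReal.inv_mul_cancel (by simp) (by simp), one_pow]
  have key : M ≤ 2 * C * Q * M ^ (1 - q) := by
    conv_lhs => rw [hM]
    refine iSup₂_le fun j y => ?_
    calc W j y ≤ (2⁻¹ : ℝ≥0∞) ^ (j * L) * (ENNReal.ofReal (om N (x - y)) *
          (C * ∑' k : ℕ, (2⁻¹ : ℝ≥0∞) ^ (k * L) * ((2 : ℝ≥0∞) ^ (j * n) *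
            ∫⁻ z, ENNReal.ofReal (om N (y - z)) * V (j + k) z))) := by
          rw [hW]; simp only
          gcongr
          exact hV j y
      _ = C * ∑' k : ℕ, (2 : ℝ≥0∞) ^ (j * n) * ((2⁻¹ : ℝ≥0∞) ^ ((j + k) * L) *
            (ENNReal.ofReal (om N (x - y)) *
              ∫⁻ z, ENNReal.ofReal (om N (y - z)) * V (j + k) z)) := by
          rw [← ENNReal.tsum_mul_left, ← ENNReal.tsum_mul_left, ← ENNReal.tsum_mul_left,
            ← ENNReal.tsum_mul_left]
          congr 1 with k
          ring
      _ ≤ C * ∑' k : ℕ, (2⁻¹ : ℝ≥0∞) ^ k * (Q * M ^ (1 - q)) := by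
          refine mul_le_mul_right (ENNReal.tsum_le_tsum fun k => ?_) _
          calc (2 : ℝ≥0∞) ^ (j * n) * ((2⁻¹ : ℝ≥0∞) ^ ((j + k) * L) *
              (ENNReal.ofReal (om N (x - y)) *
                ∫⁻ z, ENNReal.ofReal (om N (y - z)) * V (j + k) z))
              ≤ (2 : ℝ≥0∞) ^ (j * n) * ∫⁻ z, W (j + k) z := by
                gcongr
                rw [← lintegral_const_mul' _ _ ENNReal.ofReal_ne_top,
                  ← lintegral_const_mul' _ _ (ENNReal.pow_ne_top (by simp)), hW]
                refine lintegral_mono fun z => ?_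
                simp only
                refine mul_le_mul_right ?_ _
                rw [← mul_assoc]
                refine mul_le_mul_left ?_ _
                rw [← ENNReal.ofReal_mul (om_pos _ _).le]
                exact ENNReal.ofReal_le_ofReal (om_mul_le _ _ _ _)
            _ ≤ (2 : ℝ≥0∞) ^ (j * n) *
                ((2⁻¹ : ℝ≥0∞) ^ ((j + k) * (n + 1)) * (Q * M ^ (1 - q))) := by
                gcongr
                exact hWq _
            _ ≤ (2 : ℝ≥0∞) ^ (j * n) *
                ((2⁻¹ : ℝ≥0∞) ^ (j * n + k) * (Q * M ^ (1 - q))) := by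
                gcongr (2 : ℝ≥0∞) ^ (j * n) * (?_ * _)
                refine pow_le_pow_of_le_one (by simp) hhalf ?_
                nlinarith
            _ = ((2⁻¹ : ℝ≥0∞) ^ (j * n) * 2 ^ (j * n)) *
                  ((2⁻¹ : ℝ≥0∞) ^ k * (Q * M ^ (1 - q))) := by
                rw [pow_add]; ring
            _ = _ := by rw [h2, one_mul]
      _ = _ := by rw [ENNReal.tsum_mul_right, hgeo]; ring
  have hfin := self_bound M (2 * C * Q) q hq0 hMt key
  rw [← hQ]
  refine le_trans (ENNReal.rpow_le_rpow ?_ hq0.le) hfin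
  have := hWM 0 y
  rw [hW] at this
  simpa using this

/-- The grand maximal type function. -/
def GG {n : ℕ} (Φ f : Sch n) (x : En n) : ℝ≥0∞ := ⨆ j, ‖vv Φ f j x‖ₑ

lemma GG_measurable {n : ℕ} (Φ f : Sch n) : Measurable (GG Φ f) := by
  unfold GG
  exact Measurable.iSup fun j => (vv Φ f j).continuous.measurable.enorm

lemma vv_bdd {n : ℕ} (Φ f : Sch n) : ∃ B : ℝ≥0∞, B ≠ ⊤ ∧ ∀ j y, ‖vv Φ f j y‖ₑ ≤ B := by
  obtain ⟨C, hC, hf⟩ := sch_decay f 0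
  have hi : (∫⁻ z, ‖Φ z‖ₑ) ≠ ⊤ := (SchwartzMap.integrable Φ (μ := volume)).2.ne
  refine ⟨(∫⁻ z, ‖Φ z‖ₑ) * ENNReal.ofReal C, ENNReal.mul_ne_top hi ENNReal.ofReal_ne_top, ?_⟩
  intro j y
  unfold vv
  rw [cv_apply]
  refine (enorm_integral_le_lintegral_enorm _).trans ?_
  have hp := half_pow_pos j
  calc ∫⁻ z, ‖dilS ((2⁻¹ : ℝ) ^ j) hp Φ (y - z) * f z‖ₑ
      ≤ ∫⁻ z, ‖dilS ((2⁻¹ : ℝ) ^ j) hp Φ (y - z)‖ₑ * ENNReal.ofReal C := by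
        refine lintegral_mono fun z => ?_
        simp only
        rw [enorm_mul]
        gcongr
        rw [← ofReal_norm]
        refine ENNReal.ofReal_le_ofReal ((hf z).trans ?_)
        simp [om]
    _ = (∫⁻ z, ‖dilS ((2⁻¹ : ℝ) ^ j) hp Φ z‖ₑ) * ENNReal.ofReal C := by
        rw [lintegral_mul_const' _ _ ENNReal.ofReal_ne_top,
          lintegral_sub_left_eq_self (fun z => ‖dilS ((2⁻¹ : ℝ) ^ j) hp Φ z‖ₑ) y]
    _ ≤ _ := by
        refine mul_le_mul_left ?_ _
        simp_rw [dilS_apply, enorm_smul]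
        rw [lintegral_const_mul' _ _ enorm_ne_top,
          lintegral_smul_subst _ (inv_pos.2 hp) (fun z => ‖Φ z‖ₑ), ← mul_assoc,
          ← ofReal_norm, ← ENNReal.ofReal_mul (norm_nonneg _)]
        have : ‖((((2⁻¹ : ℝ) ^ j) ^ n)⁻¹ : ℝ)‖ * ((((2⁻¹ : ℝ) ^ j)⁻¹) ^ n)⁻¹ = 1 := by
          rw [Real.norm_of_nonneg (by positivity), inv_pow (((2⁻¹ : ℝ) ^ j)), inv_inv]
          exact inv_mul_cancel₀ (by positivity)
        rw [this]; simp

/-- The slowly varying majorant. -/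
def AA {n : ℕ} (N : ℕ) (q : ℝ) (G : En n → ℝ≥0∞) (x : En n) : ℝ≥0∞ :=
  (∫⁻ z, ENNReal.ofReal (om N (x - z)) ^ q * G z ^ q) ^ (1 / q)

lemma u_bound {n : ℕ} (Φ Λ : Sch n) (hΦ : ∀ ξ, ‖ξ‖ ≤ 3 → 𝓕 Φ ξ ≠ 0) (N : ℕ) (q : ℝ)
    (hq0 : 0 < q) (hq1 : q ≤ 1) :
    ∃ C : ℝ≥0∞, C ≠ ⊤ ∧ ∀ (f : Sch n) (x : En n),
      ‖cv Λ (vv Φ f 0) x‖ₑ ≤ C * AA N q (GG Φ f) x := by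
  obtain ⟨L, hL⟩ := exists_nat_ge (((n : ℝ) + 1) / q)
  rw [div_le_iff₀ hq0] at hL
  obtain ⟨C, hC, H⟩ := base_est_scaled Φ hΦ L N
  obtain ⟨C1, hC1, hd⟩ := sch_decay Λ (n + 1 + N)
  have hI : (∫⁻ z : En n, ENNReal.ofReal (om (n + 1) z)) ≠ ⊤ := by
    have := (om_integrable (n := n)).lintegral_lt_top
    exact this.ne
  refine ⟨ENNReal.ofReal C1 * ((∫⁻ z : En n, ENNReal.ofReal (om (n + 1) z)) *
    (2 * ENNReal.ofReal C) ^ (1 / q)), ?_, ?_⟩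
  · refine ENNReal.mul_ne_top ENNReal.ofReal_ne_top (ENNReal.mul_ne_top hI ?_)
    exact ENNReal.rpow_ne_top_of_nonneg (by positivity)
      (ENNReal.mul_ne_top (by simp) ENNReal.ofReal_ne_top)
  · intro f x
    obtain ⟨B, hB, hVB⟩ := vv_bdd Φ f
    have hm := m_lemma (fun j y => ‖vv Φ f j y‖ₑ) (GG Φ f) B hB hVB
      (fun j y => le_iSup (fun j => ‖vv Φ f j y‖ₑ) j) L N q hq0 hq1 hL (ENNReal.ofReal C)
      (H f) x
    have hm2 : ∀ y, ENNReal.ofReal (om N (x - y)) * ‖vv Φ f 0 y‖ₑ ≤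
        (2 * ENNReal.ofReal C) ^ (1 / q) * AA N q (GG Φ f) x := by
      intro y
      have h1 := ENNReal.rpow_le_rpow (hm y) (z := 1 / q) (by positivity)
      rw [ENNReal.mul_rpow_of_nonneg (2 * ENNReal.ofReal C) _ (by positivity), ← ENNReal.rpow_mul,
        mul_one_div_cancel hq0.ne', ENNReal.rpow_one] at h1
      exact h1
    refine (cv_enorm_le Λ (vv Φ f 0) _ C1 hd x).trans ?_
    rw [mul_assoc]
    gcongr
    calc ∫⁻ z, ENNReal.ofReal (om (n + 1 + N) (x - z)) * ‖vv Φ f 0 z‖ₑ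
        ≤ ∫⁻ z, ENNReal.ofReal (om (n + 1) (x - z)) *
            ((2 * ENNReal.ofReal C) ^ (1 / q) * AA N q (GG Φ f) x) := by
          refine lintegral_mono fun z => ?_
          simp only
          rw [om_add, ENNReal.ofReal_mul (om_pos _ _).le, mul_assoc]
          exact mul_le_mul_right (hm2 z) _
      _ = _ := by
        rw [lintegral_mul_const _ (by
          exact ((om_cont (n := n) (n + 1)).comp (continuous_const.sub continuous_id)).measurable.ennreal_ofReal),
          lintegral_sub_left_eq_self (fun z => ENNReal.ofReal (om (n + 1) z)) x, mul_assoc]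

end FS

/-! ### Part 7: representation of the Bochner-Riesz means -/

section Rep
open scoped FourierTransform SchwartzMap ContDiff

lemma brMeans_one {n : ℕ} (δ : ℝ) (g : En n → ℂ) (x : En n) :
    brMeans n δ 1 g x = ∫ y, g y * brKernel n δ (x - y) := by
  simp [brMeans, brKernelDil]

lemma brMeans_fourier {n : ℕ} (δ : ℝ) (hδ : 0 < δ) (g : Sch n) (x : En n) :
    brMeans n δ 1 g x = ∫ ξ : En n, ((brM δ ξ : ℂ) *
      Complex.exp (-(2 * Real.pi) * Complex.I * ((inner ℝ x ξ : ℝ) : ℂ))) * 𝓕 g (-ξ) := by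
  rw [brMeans_one]
  simp_rw [brKernel_eq]
  have hIntg : Integrable (Function.uncurry fun (y ξ : En n) => g y * ((brM δ ξ : ℂ) *
      Complex.exp (-(2 * Real.pi) * Complex.I * ((inner ℝ (x - y) ξ : ℝ) : ℂ))))
      (volume.prod volume) := by
    have h1 : Integrable (fun z : En n × En n => g z.1 * (brM δ z.2 : ℂ)) (volume.prod volume) :=
      (SchwartzMap.integrable g).mul_prod (brM_integrable hδ).ofReal
    refine h1.mono ?_ (Filter.Eventually.of_forall fun z => ?_)
    · refine Continuous.aestronglyMeasurable ?_
      have h2 := g.continuous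
      have h3 := brM_cont (n := n) hδ
      simp only [Function.uncurry_def]
      fun_prop
    · simp only [Function.uncurry, norm_mul, norm_exp_br, mul_one, le_refl]
  have e1 : ∀ y : En n, g y * ∫ ξ : En n, (brM δ ξ : ℂ) *
      Complex.exp (-(2 * Real.pi) * Complex.I * ((inner ℝ (x - y) ξ : ℝ) : ℂ)) =
      ∫ ξ : En n, g y * ((brM δ ξ : ℂ) *
      Complex.exp (-(2 * Real.pi) * Complex.I * ((inner ℝ (x - y) ξ : ℝ) : ℂ))) := by
    intro y
    rw [integral_const_mul]
  simp_rw [e1]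
  rw [integral_integral_swap hIntg]
  refine integral_congr_ae (Filter.Eventually.of_forall fun ξ => ?_)
  simp only
  rw [SchwartzMap.fourier_coe, Real.fourier_eq', ← integral_const_mul]
  refine integral_congr_ae (Filter.Eventually.of_forall fun y => ?_)
  simp only [smul_eq_mul]
  rw [inner_sub_left, inner_neg_right]
  rw [mul_comm (Complex.exp _) (g y), mul_assoc (_ : ℂ) (Complex.exp _) (_ : ℂ),
    mul_left_comm (Complex.exp _) (g y), ← Complex.exp_add, mul_left_comm]
  congr 3
  push_cast
  ring_nf

lemma brMeans_congr {n : ℕ} (δ : ℝ) (hδ : 0 < δ) (f g : Sch n)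
    (h : ∀ ξ, ‖ξ‖ ≤ 1 → 𝓕 f ξ = 𝓕 g ξ) (x : En n) :
    brMeans n δ 1 f x = brMeans n δ 1 g x := by
  rw [brMeans_fourier δ hδ, brMeans_fourier δ hδ]
  refine integral_congr_ae (Filter.Eventually.of_forall fun ξ => ?_)
  simp only
  by_cases hξ : ‖ξ‖ ≤ 1
  · rw [h (-ξ) (by simpa using hξ)]
  · rw [brM_zero hδ ξ (by linarith)]; simp

lemma brMeans_bound {n : ℕ} (hn : 1 ≤ n) (δ : ℝ) (hδ : 0 < δ) (Φ : Sch n)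
    (hΦ : ∀ ξ, ‖ξ‖ ≤ 3 → 𝓕 Φ ξ ≠ 0) (N : ℕ) (q : ℝ) (hq0 : 0 < q) (hq1 : q ≤ 1) :
    ∃ C : ℝ≥0∞, C ≠ ⊤ ∧ ∀ (f : Sch n) (x : En n), ‖brMeans n δ 1 f x‖ₑ ≤
      ∫⁻ y, C * AA N q (GG Φ f) y *
        ENNReal.ofReal ((1 + ‖x - y‖) ^ (-(((n : ℝ) + 1) / 2 + δ))) := by
  obtain ⟨h, hs, hinv⟩ := exists_smooth_inv (𝓕 Φ) hΦ
  obtain ⟨Lh, hLh⟩ := exists_sch (fun ξ : En n => (bmp n ξ : ℂ) * h ξ)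
    ((Complex.ofRealCLM.contDiff.comp (bmp n).contDiff).mul hs)
    (fun ξ hξ => by simp [bmp_zero hξ])
  obtain ⟨Λ, hΛ⟩ : ∃ Λ : Sch n, Λ = 𝓕⁻ Lh := ⟨_, rfl⟩
  obtain ⟨C, hC, hu⟩ := u_bound Φ Λ hΦ N q hq0 hq1
  obtain ⟨C1, hC1, hd⟩ := brKernel_decay (n := n) hn hδ
  refine ⟨C * ENNReal.ofReal C1, ENNReal.mul_ne_top hC ENNReal.ofReal_ne_top, fun f x => ?_⟩
  have e1 : brMeans n δ 1 f x = brMeans n δ 1 (cv Λ (vv Φ f 0)) x := by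
    refine brMeans_congr δ hδ _ _ (fun ξ hξ => ?_) x
    rw [fourier_cv, fourier_vv, hΛ, fourier_inv_apply, hLh, bmp_one hξ]
    simp only [pow_zero, one_smul, Complex.ofReal_one, one_mul]
    rw [← mul_assoc, hinv ξ (by linarith), one_mul]
  rw [e1, brMeans_one]
  refine (enorm_integral_le_lintegral_enorm _).trans (lintegral_mono fun y => ?_)
  simp only
  rw [enorm_mul]
  calc _ ≤ (C * AA N q (GG Φ f) y) * (ENNReal.ofReal C1 *
        ENNReal.ofReal ((1 + ‖x - y‖) ^ (-(((n : ℝ) + 1) / 2 + δ)))) := by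
        refine mul_le_mul' (hu f y) ?_
        rw [← ENNReal.ofReal_mul hC1.le, ← ofReal_norm]
        exact ENNReal.ofReal_le_ofReal (hd _)
    _ = _ := by ring

end Rep

/-! ### Part 8: weak type estimate, kernel side -/

section WeakKernel

/-- The decay profile. -/
def bb {n : ℕ} (κ : ℝ) (x : En n) : ℝ := (1 + ‖x‖) ^ (-κ)

/-- The weight attached to a ball. -/
def ww {n : ℕ} (x0 : En n) (R : ℝ) (y : En n) : ℝ := (R / (1 + R + ‖y - x0‖)) ^ n

lemma bb_pos {n : ℕ} (κ : ℝ) (x : En n) : 0 < bb κ x := by unfold bb; positivity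

lemma ww_pos {n : ℕ} (x0 : En n) {R : ℝ} (hR : 0 < R) (y : En n) : 0 < ww x0 R y := by
  unfold ww; positivity

lemma bb_cont {n : ℕ} (κ : ℝ) : Continuous (bb κ : En n → ℝ) := by
  unfold bb
  refine Continuous.rpow_const (by fun_prop) fun x => Or.inl ?_
  positivity

lemma vol_ball {n : ℕ} (x : En n) {r : ℝ} (hr : 0 < r) :
    volume (Metric.ball x r) = ENNReal.ofReal (r ^ n) * volume (Metric.ball (0 : En n) 1) := by
  rw [Measure.addHaar_ball_of_pos _ _ hr]
  simp

lemma bb_ball {n : ℕ} (κ : ℝ) (hκ : (n : ℝ) < κ) : ∃ C : ℝ≥0∞, C ≠ ⊤ ∧ C ≠ 0 ∧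
    ∀ (x0 : En n) (R : ℝ), 0 < R → ∀ y,
      ∫⁻ x in Metric.ball x0 R, ENNReal.ofReal (bb κ (x - y)) ≤ C * ENNReal.ofReal (ww x0 R y) := by
  have hI : (∫⁻ z : En n, ENNReal.ofReal (bb κ z)) ≠ ⊤ := by
    have := integrable_one_add_norm (E := En n) (μ := volume) (r := κ) (by simpa using hκ)
    exact this.lintegral_lt_top.ne
  obtain ⟨I0, hI0⟩ : ∃ I0, I0 = ∫⁻ z : En n, ENNReal.ofReal (bb κ z) := ⟨_, rfl⟩
  obtain ⟨v, hv⟩ : ∃ v, v = volume (Metric.ball (0 : En n) 1) := ⟨_, rfl⟩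
  have hvt : v ≠ ⊤ := by rw [hv]; exact measure_ball_lt_top.ne
  rw [← hI0] at hI
  refine ⟨(I0 + v + 1) * ENNReal.ofReal (4 ^ n), ?_, ?_, ?_⟩
  · refine ENNReal.mul_ne_top ?_ ENNReal.ofReal_ne_top
    simp [hI, hvt]
  · simp
  intro x0 R hR y
  have hy0 := norm_nonneg (y - x0)
  by_cases hc : ∃ x ∈ Metric.ball x0 R, ‖x - y‖ + 1 < R
  · obtain ⟨x, hx, hxy⟩ := hc
    rw [mem_ball_iff_norm] at hx
    have h1 : 1 + R + ‖y - x0‖ ≤ 4 * R := by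
      have : ‖y - x0‖ ≤ ‖y - x‖ + ‖x - x0‖ := norm_sub_le_norm_sub_add_norm_sub _ _ _
      rw [norm_sub_rev y x] at this
      have := norm_nonneg (x - y)
      linarith
    have h2 : 1 ≤ 4 ^ n * ww x0 R y := by
      unfold ww
      rw [← mul_pow]
      refine one_le_pow₀ ?_
      rw [← mul_div_assoc, le_div_iff₀ (by positivity)]
      linarith
    calc ∫⁻ x in Metric.ball x0 R, ENNReal.ofReal (bb κ (x - y))
        ≤ ∫⁻ x, ENNReal.ofReal (bb κ (x - y)) := setLIntegral_le_lintegral _ _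
      _ = I0 := by rw [hI0]; exact lintegral_sub_right_eq_self (fun z => ENNReal.ofReal (bb κ z)) y
      _ ≤ (I0 + v + 1) * 1 := by rw [mul_one, add_assoc]; exact le_self_add
      _ ≤ (I0 + v + 1) * ENNReal.ofReal (4 ^ n * ww x0 R y) := by
          gcongr
          simpa using ENNReal.ofReal_le_ofReal h2
      _ = _ := by rw [ENNReal.ofReal_mul (by positivity), mul_assoc]
  · push Not at hc
    have h1 : ∀ x ∈ Metric.ball x0 R, ENNReal.ofReal (bb κ (x - y)) ≤
        ENNReal.ofReal (4 ^ n * (1 / (1 + R + ‖y - x0‖)) ^ n) := by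
      intro x hx
      refine ENNReal.ofReal_le_ofReal ?_
      have h2 := hc x hx
      rw [mem_ball_iff_norm] at hx
      have h3 : 1 + R + ‖y - x0‖ ≤ 4 * (1 + ‖x - y‖) := by
        have : ‖y - x0‖ ≤ ‖y - x‖ + ‖x - x0‖ := norm_sub_le_norm_sub_add_norm_sub _ _ _
        rw [norm_sub_rev y x] at this
        have := norm_nonneg (x - y)
        linarith
      have h4 : (0 : ℝ) < 1 + ‖x - y‖ := by positivity
      calc bb κ (x - y) ≤ (1 + ‖x - y‖) ^ (-(n : ℝ)) := by
            unfold bb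
            exact Real.rpow_le_rpow_of_exponent_le (by linarith [norm_nonneg (x - y)]) (by linarith)
        _ = (1 / (1 + ‖x - y‖)) ^ n := by
            rw [Real.rpow_neg h4.le, Real.rpow_natCast, one_div, inv_pow]
        _ ≤ (4 * (1 / (1 + R + ‖y - x0‖))) ^ n := by
            gcongr
            rw [mul_one_div, div_le_div_iff₀ h4 (by positivity)]
            linarith
        _ = _ := by rw [mul_pow]
    calc ∫⁻ x in Metric.ball x0 R, ENNReal.ofReal (bb κ (x - y))
        ≤ ∫⁻ x in Metric.ball x0 R, ENNReal.ofReal (4 ^ n * (1 / (1 + R + ‖y - x0‖)) ^ n) :=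
          setLIntegral_mono' measurableSet_ball h1
      _ = v * (ENNReal.ofReal (4 ^ n) * ENNReal.ofReal (ww x0 R y)) := by
          rw [setLIntegral_const, vol_ball x0 hR, ← hv, mul_comm _ v, mul_left_comm,
            ← ENNReal.ofReal_mul (by positivity), ← ENNReal.ofReal_mul (by positivity)]
          congr 2
          unfold ww
          rw [div_pow, div_pow]
          ring
      _ ≤ (I0 + v + 1) * (ENNReal.ofReal (4 ^ n) * ENNReal.ofReal (ww x0 R y)) := by
          gcongr
          rw [add_comm I0, add_assoc]; exact le_self_add
      _ = _ := by rw [mul_assoc]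

lemma bb_min {n : ℕ} (κ : ℝ) (hκ : 0 < κ) (ρ : ℝ) (hρ : 0 < ρ) (x : En n) :
    min (ρ ^ κ * bb κ x) 1 ≤ 2 ^ κ * bb κ (ρ⁻¹ • x) := by
  unfold bb
  rw [norm_smul, norm_inv, Real.norm_of_nonneg hρ.le]
  have hr := norm_nonneg x
  obtain ⟨r, hrr⟩ : ∃ r, r = ‖x‖ := ⟨_, rfl⟩
  rw [← hrr] at hr ⊢
  rw [Real.rpow_neg (by positivity), Real.rpow_neg (by positivity), ← div_eq_mul_inv,
    ← div_eq_mul_inv, ← Real.div_rpow (by positivity) (by positivity),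
    ← Real.div_rpow (by positivity) (by positivity)]
  have e : 1 + ρ⁻¹ * r = (ρ + r) / ρ := by field_simp
  rw [e]
  by_cases h : r ≤ ρ
  · refine (min_le_right _ _).trans ?_
    refine Real.one_le_rpow ?_ hκ.le
    rw [div_div_eq_mul_div, le_div_iff₀ (by positivity)]
    linarith
  · refine (min_le_left _ _).trans ?_
    push Not at h
    refine Real.rpow_le_rpow (by positivity) ?_ hκ.le
    rw [div_div_eq_mul_div, div_le_div_iff₀ (by positivity) (by positivity)]
    nlinarith

lemma min_ball {n : ℕ} (κ : ℝ) (hκ : (n : ℝ) < κ) (q : ℝ) (hq1 : q ≤ 1) (hq0 : 0 < q)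
    (hqc : (n : ℝ) / κ ≤ q) :
    ∃ C : ℝ≥0∞, C ≠ ⊤ ∧ ∀ (s : ℝ≥0∞) (x0 : En n) (R : ℝ), 0 < R → ∀ y,
      ∫⁻ x in Metric.ball x0 R, min (s * ENNReal.ofReal (bb κ (x - y))) 1 ≤
        C * (s ^ q * ENNReal.ofReal (ww x0 R y)) := by
  obtain ⟨C, hC, hC0, H⟩ := bb_ball (n := n) κ hκ
  have hκ0 : 0 < κ := lt_of_le_of_lt (by positivity) hκ
  have h2κ : (1 : ℝ) ≤ 2 ^ κ := Real.one_le_rpow (by norm_num) hκ0.le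
  refine ⟨ENNReal.ofReal (2 ^ κ) * C, ENNReal.mul_ne_top ENNReal.ofReal_ne_top hC, ?_⟩
  intro s x0 R hR y
  by_cases hs : s = ⊤
  · have : (0 : ℝ) < 2 ^ κ := by linarith
    rw [hs, ENNReal.top_rpow_of_pos hq0, ENNReal.top_mul, ENNReal.mul_top]
    · exact le_top
    · simp [hC0, this]
    · simpa using ww_pos x0 hR y
  by_cases hs1 : s ≤ 1
  · calc ∫⁻ x in Metric.ball x0 R, min (s * ENNReal.ofReal (bb κ (x - y))) 1
        ≤ ∫⁻ x in Metric.ball x0 R, s * ENNReal.ofReal (bb κ (x - y)) :=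
          lintegral_mono fun x => min_le_left _ _
      _ = s * ∫⁻ x in Metric.ball x0 R, ENNReal.ofReal (bb κ (x - y)) :=
          lintegral_const_mul' _ _ hs
      _ ≤ s ^ q * (C * ENNReal.ofReal (ww x0 R y)) := by
          gcongr
          · conv_lhs => rw [← ENNReal.rpow_one s]
            exact ENNReal.rpow_le_rpow_of_exponent_ge hs1 hq1
          · exact H x0 R hR y
      _ = 1 * C * (s ^ q * ENNReal.ofReal (ww x0 R y)) := by ring
      _ ≤ _ := by
          gcongr
          simpa using ENNReal.ofReal_le_ofReal h2κ
  · push Not at hs1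
    obtain ⟨σ, hσ⟩ : ∃ σ, σ = s.toReal := ⟨_, rfl⟩
    have hsσ : s = ENNReal.ofReal σ := by rw [hσ, ENNReal.ofReal_toReal hs]
    have hσ1 : 1 < σ := by
      rw [hsσ] at hs1
      simpa using hs1
    obtain ⟨ρ, hρ⟩ : ∃ ρ, ρ = σ ^ (1 / κ) := ⟨_, rfl⟩
    have hρ1 : 1 ≤ ρ := by rw [hρ]; exact Real.one_le_rpow hσ1.le (by positivity)
    have hρ0 : 0 < ρ := by linarith
    have hρκ : ρ ^ κ = σ := by
      rw [hρ, ← Real.rpow_mul (by linarith), one_div, inv_mul_cancel₀ hκ0.ne', Real.rpow_one]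
    have hpt : ∀ x, min (s * ENNReal.ofReal (bb κ (x - y))) 1 ≤
        ENNReal.ofReal (2 ^ κ) * ENNReal.ofReal (bb κ (ρ⁻¹ • x - ρ⁻¹ • y)) := by
      intro x
      rw [hsσ, ← ENNReal.ofReal_mul (by linarith), ← ENNReal.ofReal_mul (by linarith),
        ← ENNReal.ofReal_one, ← ENNReal.ofReal_min, ← smul_sub]
      refine ENNReal.ofReal_le_ofReal ?_
      have := bb_min κ hκ0 ρ hρ0 (x - y)
      rwa [hρκ] at this
    obtain ⟨F, hF⟩ : ∃ F : En n → ℝ≥0∞, F = (Metric.ball (ρ⁻¹ • x0) (ρ⁻¹ * R)).indicator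
      (fun x => ENNReal.ofReal (bb κ (x - ρ⁻¹ • y))) := ⟨_, rfl⟩
    have hFs : ∀ x, F (ρ⁻¹ • x) = (Metric.ball x0 R).indicator
        (fun x => ENNReal.ofReal (bb κ (ρ⁻¹ • x - ρ⁻¹ • y))) x := by
      intro x
      rw [hF]
      have : ρ⁻¹ • x ∈ Metric.ball (ρ⁻¹ • x0) (ρ⁻¹ * R) ↔ x ∈ Metric.ball x0 R := by
        rw [mem_ball_iff_norm, mem_ball_iff_norm, ← smul_sub, norm_smul, norm_inv,
          Real.norm_of_nonneg hρ0.le, mul_lt_mul_iff_right₀ (inv_pos.2 hρ0)]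
      by_cases hx : x ∈ Metric.ball x0 R
      · rw [indicator_of_mem hx, indicator_of_mem (this.2 hx)]
      · rw [indicator_of_notMem hx, indicator_of_notMem (fun h => hx (this.1 h))]
    calc ∫⁻ x in Metric.ball x0 R, min (s * ENNReal.ofReal (bb κ (x - y))) 1
        ≤ ∫⁻ x in Metric.ball x0 R,
            ENNReal.ofReal (2 ^ κ) * ENNReal.ofReal (bb κ (ρ⁻¹ • x - ρ⁻¹ • y)) :=
          lintegral_mono fun x => hpt x
      _ = ENNReal.ofReal (2 ^ κ) * ∫⁻ x, F (ρ⁻¹ • x) := by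
          rw [lintegral_const_mul' _ _ ENNReal.ofReal_ne_top]
          simp_rw [hFs]
          rw [lintegral_indicator measurableSet_ball]
      _ = ENNReal.ofReal (2 ^ κ) * (ENNReal.ofReal (ρ ^ n) *
            ∫⁻ x in Metric.ball (ρ⁻¹ • x0) (ρ⁻¹ * R), ENNReal.ofReal (bb κ (x - ρ⁻¹ • y))) := by
          rw [lintegral_smul_subst _ (inv_pos.2 hρ0), hF, lintegral_indicator measurableSet_ball,
            inv_pow, inv_inv]
      _ ≤ ENNReal.ofReal (2 ^ κ) * (ENNReal.ofReal (ρ ^ n) *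
            (C * ENNReal.ofReal (ww (ρ⁻¹ • x0) (ρ⁻¹ * R) (ρ⁻¹ • y)))) := by
          gcongr
          exact H _ _ (by positivity) _
      _ = ENNReal.ofReal (2 ^ κ) * C * (ENNReal.ofReal (ρ ^ n) *
            ENNReal.ofReal (ww (ρ⁻¹ • x0) (ρ⁻¹ * R) (ρ⁻¹ • y))) := by ring
      _ ≤ _ := by
          gcongr
          · rw [hsσ, ENNReal.ofReal_rpow_of_pos (by linarith)]
            refine ENNReal.ofReal_le_ofReal ?_
            rw [hρ, ← Real.rpow_natCast, ← Real.rpow_mul (by linarith)]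
            refine Real.rpow_le_rpow_of_exponent_le hσ1.le ?_
            rw [one_div_mul_eq_div]; exact hqc
          · unfold ww
            rw [← smul_sub, norm_smul, norm_inv, Real.norm_of_nonneg hρ0.le]
            gcongr ?_ ^ n
            rw [div_le_div_iff₀ (by positivity) (by positivity)]
            have hn0 := norm_nonneg (y - x0)
            have e : R * (1 + ρ⁻¹ * R + ρ⁻¹ * ‖y - x0‖) =
              ρ⁻¹ * R * (ρ + R + ‖y - x0‖) := by field_simp
            rw [e]
            gcongr

/-- Either the function is large on a unit ball, or it is everywhere at most one. -/
lemma one_le_min {n : ℕ} (D : ℝ≥0∞) (hD : 1 ≤ D) (F : En n → ℝ≥0∞)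
    (hF : ∀ y y', ‖y - y'‖ ≤ 1 → F y' ≤ D * F y) (h : 1 < ∫⁻ y, F y) :
    1 ≤ (1 + (volume (Metric.ball (0 : En n) 1))⁻¹) * ∫⁻ y, min (D * F y) 1 := by
  by_cases hc : ∃ y0, 1 < F y0
  · obtain ⟨y0, hy0⟩ := hc
    have h1 : volume (Metric.ball (0 : En n) 1) ≤ ∫⁻ y, min (D * F y) 1 := by
      calc volume (Metric.ball (0 : En n) 1) = ∫⁻ y in Metric.ball y0 1, 1 := by
            rw [setLIntegral_one, vol_ball y0 one_pos]; simp
        _ ≤ ∫⁻ y in Metric.ball y0 1, min (D * F y) 1 := by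
            refine setLIntegral_mono' measurableSet_ball fun y hy => ?_
            refine le_min ?_ le_rfl
            rw [mem_ball_iff_norm] at hy
            exact hy0.le.trans (hF y y0 hy.le)
        _ ≤ _ := setLIntegral_le_lintegral _ _
    have h0 : volume (Metric.ball (0 : En n) 1) ≠ 0 := (Metric.measure_ball_pos _ _ one_pos).ne'
    have ht : volume (Metric.ball (0 : En n) 1) ≠ ⊤ := measure_ball_lt_top.ne
    calc 1 = (volume (Metric.ball (0 : En n) 1))⁻¹ * volume (Metric.ball (0 : En n) 1) :=
          (ENNReal.inv_mul_cancel h0 ht).symm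
      _ ≤ _ := by
        gcongr
        exact le_add_self
  · push Not at hc
    calc 1 ≤ ∫⁻ y, F y := h.le
      _ ≤ ∫⁻ y, min (D * F y) 1 := by
          refine lintegral_mono fun y => le_min ?_ (hc y)
          exact le_mul_of_one_le_left' hD
      _ ≤ _ := le_mul_of_one_le_left' le_self_add

end WeakKernel

/-! ### Part 9: weak type estimate -/

section WeakType

lemma morrey_ball {n : ℕ} (p q : ℝ) (hq0 : 0 < q) (G : En n → ℝ≥0∞) (x : En n) (r : ℝ)
    (hr : 0 < r) : ∫⁻ y in Metric.ball x r, G y ^ q ≤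
      volume (Metric.ball x r) ^ (1 - q / p) * morreyQ n p q G ^ q := by
  have h0 : volume (Metric.ball x r) ≠ 0 := (Metric.measure_ball_pos _ _ hr).ne'
  have ht : volume (Metric.ball x r) ≠ ⊤ := measure_ball_lt_top.ne
  have h : volume (Metric.ball x r) ^ (1 / p - 1 / q) *
      (∫⁻ y in Metric.ball x r, G y ^ q) ^ (1 / q) ≤ morreyQ n p q G := by
    unfold morreyQ
    exact le_iSup_of_le x (le_iSup_of_le r (le_iSup_of_le hr le_rfl))
  have h1 := ENNReal.rpow_le_rpow h hq0.le
  rw [ENNReal.mul_rpow_of_nonneg _ _ hq0.le, ← ENNReal.rpow_mul, ← ENNReal.rpow_mul,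
    one_div_mul_cancel hq0.ne', ENNReal.rpow_one] at h1
  have e : (1 - q / p) + (1 / p - 1 / q) * q = 0 := by
    have : 1 / q * q = 1 := one_div_mul_cancel hq0.ne'
    rw [sub_mul, this]; ring
  calc ∫⁻ y in Metric.ball x r, G y ^ q
      = volume (Metric.ball x r) ^ (1 - q / p) * (volume (Metric.ball x r) ^ ((1 / p - 1 / q) * q) *
        ∫⁻ y in Metric.ball x r, G y ^ q) := by
        rw [← mul_assoc, ← ENNReal.rpow_add _ _ h0 ht, e, ENNReal.rpow_zero, one_mul]
    _ ≤ _ := by gcongr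

lemma ww_dyadic {n : ℕ} (x0 : En n) (R : ℝ) (hR : 0 < R) (z : En n) :
    ENNReal.ofReal (ww x0 R z) ≤ ∑' j : ℕ, (2 : ℝ≥0∞) ^ n * (2⁻¹ : ℝ≥0∞) ^ (j * n) *
      (Metric.ball x0 (2 ^ j * R)).indicator 1 z := by
  have hex : ∃ j : ℕ, ‖z - x0‖ < 2 ^ j * R := by
    obtain ⟨j, hj⟩ := pow_unbounded_of_one_lt (‖z - x0‖ / R) (one_lt_two)
    exact ⟨j, by rwa [div_lt_iff₀ hR] at hj⟩
  classical
  have hj := Nat.find_spec hex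
  have hmin := fun m => Nat.find_min hex (m := m)
  obtain ⟨j, hjj⟩ : ∃ j, j = Nat.find hex := ⟨_, rfl⟩
  rw [← hjj] at hj hmin
  refine le_trans ?_ (ENNReal.le_tsum j)
  rw [indicator_of_mem (by rwa [mem_ball_iff_norm])]
  simp only [Pi.one_apply, mul_one]
  have hz := norm_nonneg (z - x0)
  have h2 : (2 : ℝ≥0∞) ^ n * (2⁻¹ : ℝ≥0∞) ^ (j * n) = ENNReal.ofReal ((2 * (2⁻¹) ^ j) ^ n) := by
    rw [mul_pow, ← pow_mul, ENNReal.ofReal_mul (by positivity), ENNReal.ofReal_pow (by norm_num),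
      ENNReal.ofReal_pow (by norm_num), ENNReal.ofReal_inv_of_pos (by norm_num),
      ENNReal.ofReal_ofNat]
  rw [h2]
  refine ENNReal.ofReal_le_ofReal ?_
  unfold ww
  gcongr ?_ ^ n
  rw [div_le_iff₀ (by positivity)]
  rcases Nat.eq_zero_or_pos j with h0 | h0
  · rw [h0]; norm_num; nlinarith
  · obtain ⟨m, rfl⟩ : ∃ m, j = m + 1 := ⟨j - 1, by omega⟩
    have h3 := hmin m (by omega)
    push Not at h3
    have e : 2 * (2⁻¹ : ℝ) ^ (m + 1) = (2 ^ m)⁻¹ := by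
      rw [pow_succ, inv_pow]; ring
    rw [e, inv_mul_eq_div, le_div_iff₀ (by positivity)]
    nlinarith

lemma int_Gw {n : ℕ} (hn : 1 ≤ n) (p q : ℝ) (hq0 : 0 < q) (hqp : q ≤ p) :
    ∃ C : ℝ≥0∞, C ≠ ⊤ ∧ ∀ (G : En n → ℝ≥0∞), Measurable G → ∀ (x0 : En n) (R : ℝ), 0 < R →
      ∫⁻ z, G z ^ q * ENNReal.ofReal (ww x0 R z) ≤
        C * (volume (Metric.ball x0 R) ^ (1 - q / p) * morreyQ n p q G ^ q) := by
  have hp : 0 < p := by linarith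
  obtain ⟨r, hr⟩ : ∃ r, r = (2⁻¹ : ℝ≥0∞) ^ ((n : ℝ) * (q / p)) := ⟨_, rfl⟩
  have hn0 : (0 : ℝ) < n := by exact_mod_cast hn
  have hr1 : r < 1 := by
    rw [hr]
    refine ENNReal.rpow_lt_one (by simp) (by positivity)
  have hqp1 : 0 ≤ 1 - q / p := by
    rw [sub_nonneg, div_le_one hp]; exact hqp
  refine ⟨2 ^ n * (1 - r)⁻¹, ?_, ?_⟩
  · refine ENNReal.mul_ne_top (ENNReal.pow_ne_top (by simp)) ?_
    rw [ENNReal.inv_ne_top]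
    exact (tsub_pos_of_lt hr1).ne'
  intro G hG x0 R hR
  obtain ⟨K, hK⟩ : ∃ K, K = morreyQ n p q G := ⟨_, rfl⟩
  obtain ⟨v, hv⟩ : ∃ v, v = volume (Metric.ball x0 R) := ⟨_, rfl⟩
  have hvol : ∀ j : ℕ, volume (Metric.ball x0 (2 ^ j * R)) = 2 ^ (j * n) * v := by
    intro j
    rw [hv, vol_ball x0 hR, vol_ball x0 (by positivity : (0:ℝ) < 2 ^ j * R), mul_pow,
      ENNReal.ofReal_mul (by positivity), mul_assoc, ← pow_mul, ENNReal.ofReal_pow (by norm_num),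
      ENNReal.ofReal_ofNat]
  have hGm : ∀ j : ℕ, Measurable fun z => G z ^ q * ((2 : ℝ≥0∞) ^ n * (2⁻¹ : ℝ≥0∞) ^ (j * n) *
      (Metric.ball x0 (2 ^ j * R)).indicator 1 z) := by
    intro j
    refine (hG.pow_const q).mul (Measurable.const_mul ?_ _)
    exact measurable_one.indicator measurableSet_ball
  calc ∫⁻ z, G z ^ q * ENNReal.ofReal (ww x0 R z)
      ≤ ∫⁻ z, ∑' j : ℕ, G z ^ q * ((2 : ℝ≥0∞) ^ n * (2⁻¹ : ℝ≥0∞) ^ (j * n) *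
          (Metric.ball x0 (2 ^ j * R)).indicator 1 z) := by
        refine lintegral_mono fun z => ?_
        simp only
        rw [ENNReal.tsum_mul_left]
        exact mul_le_mul_right (ww_dyadic x0 R hR z) _
    _ = ∑' j : ℕ, ∫⁻ z, G z ^ q * ((2 : ℝ≥0∞) ^ n * (2⁻¹ : ℝ≥0∞) ^ (j * n) *
          (Metric.ball x0 (2 ^ j * R)).indicator 1 z) :=
        lintegral_tsum fun j => (hGm j).aemeasurable
    _ = ∑' j : ℕ, (2 : ℝ≥0∞) ^ n * (2⁻¹ : ℝ≥0∞) ^ (j * n) *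
          ∫⁻ z in Metric.ball x0 (2 ^ j * R), G z ^ q := by
        congr 1 with j
        rw [← lintegral_indicator measurableSet_ball, ← lintegral_const_mul']
        · congr 1 with z
          by_cases hz : z ∈ Metric.ball x0 (2 ^ j * R)
          · rw [indicator_of_mem hz, indicator_of_mem hz]; simp [mul_comm]
          · rw [indicator_of_notMem hz, indicator_of_notMem hz]; simp
        · exact ENNReal.mul_ne_top (ENNReal.pow_ne_top (by simp)) (ENNReal.pow_ne_top (by simp))
    _ ≤ ∑' j : ℕ, r ^ j * (2 ^ n * (v ^ (1 - q / p) * K ^ q)) := by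
        refine ENNReal.tsum_le_tsum fun j => ?_
        have h1 := morrey_ball p q hq0 G x0 (2 ^ j * R) (by positivity)
        rw [hvol, ← hK, ENNReal.mul_rpow_of_nonneg _ _ hqp1] at h1
        have h2 : (2⁻¹ : ℝ≥0∞) ^ (j * n) * ((2 : ℝ≥0∞) ^ (j * n)) ^ (1 - q / p) = r ^ j := by
          rw [hr, ← ENNReal.rpow_natCast, ← ENNReal.rpow_natCast, ← ENNReal.rpow_natCast,
            ← ENNReal.rpow_mul, ← ENNReal.rpow_mul, ENNReal.inv_rpow, ENNReal.inv_rpow,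
            ← ENNReal.rpow_neg, ← ENNReal.rpow_neg, ← ENNReal.rpow_add _ _ (by simp) (by simp)]
          congr 1
          push_cast
          ring
        calc (2 : ℝ≥0∞) ^ n * (2⁻¹ : ℝ≥0∞) ^ (j * n) *
              ∫⁻ z in Metric.ball x0 (2 ^ j * R), G z ^ q
            ≤ (2 : ℝ≥0∞) ^ n * (2⁻¹ : ℝ≥0∞) ^ (j * n) *
              (((2 : ℝ≥0∞) ^ (j * n)) ^ (1 - q / p) * v ^ (1 - q / p) * K ^ q) :=
              mul_le_mul_right h1 _
          _ = ((2⁻¹ : ℝ≥0∞) ^ (j * n) * ((2 : ℝ≥0∞) ^ (j * n)) ^ (1 - q / p)) *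
              (2 ^ n * (v ^ (1 - q / p) * K ^ q)) := by ring
          _ = _ := by rw [h2]
    _ = _ := by
      rw [ENNReal.tsum_mul_right, ENNReal.tsum_geometric, hv, hK]; ring

lemma om_ww {n : ℕ} (N : ℕ) (q : ℝ) (hN : 2 * (n : ℝ) + 1 ≤ N * q)
    (x0 : En n) (R : ℝ) (hR : 0 < R) (y z : En n) :
    ENNReal.ofReal (om N (y - z)) ^ q * ENNReal.ofReal (ww x0 R y) ≤
      ENNReal.ofReal (om (n + 1) (y - z)) * ENNReal.ofReal (ww x0 R z) := by
  rw [ENNReal.ofReal_rpow_of_pos (om_pos _ _),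
    ← ENNReal.ofReal_mul (Real.rpow_nonneg (om_pos _ _).le _),
    ← ENNReal.ofReal_mul (om_pos _ _).le]
  refine ENNReal.ofReal_le_ofReal ?_
  have h0 : (0 : ℝ) < 1 + ‖y - z‖ := by positivity
  have h1 : om N (y - z) ^ q ≤ om (n + 1) (y - z) * om n (y - z) := by
    rw [← om_add]
    unfold om
    rw [← Real.rpow_natCast, ← Real.rpow_natCast, Real.inv_rpow (by positivity),
      ← Real.rpow_mul h0.le]
    gcongr
    · linarith [norm_nonneg (y - z)]
    · push_cast; linarith
  have h2 : om n (y - z) * ww x0 R y ≤ ww x0 R z := by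
    unfold om ww
    rw [← inv_pow, ← mul_pow]
    gcongr
    rw [inv_mul_eq_div, div_div, div_le_div_iff₀ (by positivity) (by positivity)]
    gcongr
    have h3 : ‖z - x0‖ ≤ ‖z - y‖ + ‖y - x0‖ := norm_sub_le_norm_sub_add_norm_sub _ _ _
    rw [norm_sub_rev z y] at h3
    have h4 := norm_nonneg (y - z)
    have h5 := norm_nonneg (y - x0)
    nlinarith [mul_nonneg h4 h5, mul_nonneg hR.le h4]
  calc om N (y - z) ^ q * ww x0 R y ≤ (om (n + 1) (y - z) * om n (y - z)) * ww x0 R y := by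
        gcongr
        exact (ww_pos x0 hR y).le
    _ = om (n + 1) (y - z) * (om n (y - z) * ww x0 R y) := by ring
    _ ≤ _ := by
        gcongr
        exact (om_pos _ _).le

lemma AA_meas_aux {n : ℕ} (N : ℕ) (q : ℝ) (G : En n → ℝ≥0∞) (hG : Measurable G) :
    Measurable (fun a : En n × En n => ENNReal.ofReal (om N (a.1 - a.2)) ^ q * G a.2 ^ q) := by
  refine Measurable.mul ?_ ((hG.comp measurable_snd).pow_const q)
  refine Measurable.pow_const ?_ q
  exact ((om_cont (n := n) N).comp (continuous_fst.sub continuous_snd)).measurable.ennreal_ofReal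

lemma AA_measurable {n : ℕ} (N : ℕ) (q : ℝ) (G : En n → ℝ≥0∞) (hG : Measurable G) :
    Measurable (AA N q G) := by
  unfold AA
  exact Measurable.pow_const (Measurable.lintegral_prod_right' (AA_meas_aux N q G hG)) _

lemma ww_cont {n : ℕ} (x0 : En n) (R : ℝ) (hR : 0 < R) : Continuous (ww x0 R) := by
  unfold ww
  refine Continuous.pow (Continuous.div continuous_const (by fun_prop) fun y => ?_) n
  positivity

lemma int_Aw {n : ℕ} (N : ℕ) (q : ℝ) (hq0 : 0 < q) (hN : 2 * (n : ℝ) + 1 ≤ N * q)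
    (G : En n → ℝ≥0∞) (hG : Measurable G) (x0 : En n) (R : ℝ) (hR : 0 < R) :
    ∫⁻ y, AA N q G y ^ q * ENNReal.ofReal (ww x0 R y) ≤
      (∫⁻ z : En n, ENNReal.ofReal (om (n + 1) z)) *
        ∫⁻ z, G z ^ q * ENNReal.ofReal (ww x0 R z) := by
  have e1 : ∀ y, AA N q G y ^ q * ENNReal.ofReal (ww x0 R y) ≤
      ∫⁻ z, ENNReal.ofReal (om (n + 1) (y - z)) * (G z ^ q * ENNReal.ofReal (ww x0 R z)) := by
    intro y
    unfold AA
    rw [← ENNReal.rpow_mul, one_div_mul_cancel hq0.ne', ENNReal.rpow_one,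
      ← lintegral_mul_const' _ _ ENNReal.ofReal_ne_top]
    refine lintegral_mono fun z => ?_
    simp only
    calc _ = ENNReal.ofReal (om N (y - z)) ^ q * ENNReal.ofReal (ww x0 R y) * G z ^ q := by ring
      _ ≤ ENNReal.ofReal (om (n + 1) (y - z)) * ENNReal.ofReal (ww x0 R z) * G z ^ q :=
        mul_le_mul_left (om_ww N q hN x0 R hR y z) _
      _ = _ := by ring
  have hwm : Measurable fun z => ENNReal.ofReal (ww x0 R z) :=
    (ww_cont x0 R hR).measurable.ennreal_ofReal
  refine (lintegral_mono e1).trans ?_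
  rw [lintegral_lintegral_swap]
  · refine le_of_eq ?_
    have hm : Measurable fun z => G z ^ q * ENNReal.ofReal (ww x0 R z) :=
      (hG.pow_const q).mul hwm
    rw [← lintegral_const_mul _ hm]
    congr 1 with z
    rw [lintegral_mul_const,
      lintegral_sub_right_eq_self (fun y => ENNReal.ofReal (om (n + 1) y)) z]
    exact ((om_cont (n := n) (n + 1)).comp
      (continuous_id.sub continuous_const)).measurable.ennreal_ofReal
  · refine Measurable.aemeasurable ?_
    refine Measurable.mul ?_ (((hG.pow_const q).mul hwm).comp measurable_snd)
    exact ((om_cont (n := n) (n + 1)).comp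
      (continuous_fst.sub continuous_snd)).measurable.ennreal_ofReal

lemma AA_slow {n : ℕ} (N : ℕ) (q : ℝ) (hq0 : 0 < q) (G : En n → ℝ≥0∞) (y y' : En n)
    (h : ‖y - y'‖ ≤ 1) : AA N q G y' ≤ ENNReal.ofReal (2 ^ N) * AA N q G y := by
  have h1 : ∀ z, om N (y' - z) ≤ 2 ^ N * om N (y - z) := by
    intro z
    unfold om
    rw [← div_eq_mul_inv, ← div_pow, ← inv_pow]
    gcongr
    rw [inv_eq_one_div, div_le_div_iff₀ (by positivity) (by positivity)]
    have : ‖y - z‖ ≤ ‖y - y'‖ + ‖y' - z‖ := norm_sub_le_norm_sub_add_norm_sub _ _ _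
    linarith [norm_nonneg (y' - z)]
  have e : ENNReal.ofReal (2 ^ N) * AA N q G y =
      (∫⁻ z, ENNReal.ofReal (2 ^ N) ^ q * (ENNReal.ofReal (om N (y - z)) ^ q * G z ^ q))
        ^ (1 / q) := by
    unfold AA
    rw [lintegral_const_mul' _ _ (ENNReal.rpow_ne_top_of_nonneg hq0.le ENNReal.ofReal_ne_top),
      ENNReal.mul_rpow_of_nonneg _ _ (by positivity), ← ENNReal.rpow_mul,
      mul_one_div_cancel hq0.ne', ENNReal.rpow_one]
  rw [e]
  unfold AA
  refine ENNReal.rpow_le_rpow (lintegral_mono fun z => ?_) (by positivity)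
  simp only
  rw [← mul_assoc, ← ENNReal.mul_rpow_of_nonneg (ENNReal.ofReal (2 ^ N)) _ hq0.le,
    ← ENNReal.ofReal_mul (by positivity)]
  exact mul_le_mul_left (ENNReal.rpow_le_rpow (ENNReal.ofReal_le_ofReal (h1 z)) hq0.le) _

lemma bb_slow {n : ℕ} (κ : ℝ) (hκ : 0 < κ) (x y y' : En n) (h : ‖y - y'‖ ≤ 1) :
    bb κ (x - y') ≤ 2 ^ κ * bb κ (x - y) := by
  unfold bb
  rw [Real.rpow_neg (by positivity), Real.rpow_neg (by positivity), ← div_eq_mul_inv,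
    ← Real.div_rpow (by positivity) (by positivity), ← Real.inv_rpow (by positivity)]
  refine Real.rpow_le_rpow (by positivity) ?_ hκ.le
  rw [inv_eq_one_div, div_le_div_iff₀ (by positivity) (by positivity)]
  have : ‖x - y‖ ≤ ‖x - y'‖ + ‖y' - y‖ := norm_sub_le_norm_sub_add_norm_sub _ _ _
  rw [norm_sub_rev y' y] at this
  linarith [norm_nonneg (x - y')]

end WeakType

/-! ### Part 10: weak type conclusion at unit scale -/

section WeakConcl

lemma weak_type {n : ℕ} (hn : 1 ≤ n) (κ : ℝ) (hκ : (n : ℝ) < κ) (p q : ℝ) (hq0 : 0 < q)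
    (hq1 : q ≤ 1) (hqp : q ≤ p) (hqc : (n : ℝ) / κ ≤ q) (N : ℕ) (hN : 2 * (n : ℝ) + 1 ≤ N * q)
    (C0 : ℝ≥0∞) (hC0 : C0 ≠ ⊤) :
    ∃ C : ℝ≥0∞, C ≠ ⊤ ∧ ∀ (G T : En n → ℝ≥0∞), Measurable G →
      (∀ x, T x ≤ ∫⁻ y, C0 * AA N q G y * ENNReal.ofReal (bb κ (x - y))) →
      morreyWQ n p q T ≤ C * morreyQ n p q G := by
  obtain ⟨C2, hC2, H2⟩ := min_ball (n := n) κ hκ q hq1 hq0 hqc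
  obtain ⟨C3, hC3, H3⟩ := int_Gw hn p q hq0 hqp
  have hκ0 : 0 < κ := lt_of_le_of_lt (by positivity) hκ
  have hI : (∫⁻ z : En n, ENNReal.ofReal (om (n + 1) z)) ≠ ⊤ :=
    (om_integrable (n := n)).lintegral_lt_top.ne
  obtain ⟨I0, hI0⟩ : ∃ I0, I0 = ∫⁻ z : En n, ENNReal.ofReal (om (n + 1) z) := ⟨_, rfl⟩
  rw [← hI0] at hI
  obtain ⟨c0, hc0⟩ : ∃ c0, c0 = 1 + (volume (Metric.ball (0 : En n) 1))⁻¹ := ⟨_, rfl⟩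
  have hc0t : c0 ≠ ⊤ := by
    rw [hc0]
    refine ENNReal.add_ne_top.2 ⟨by simp, ?_⟩
    rw [ENNReal.inv_ne_top]
    exact (Metric.measure_ball_pos _ _ one_pos).ne'
  obtain ⟨D, hD⟩ : ∃ D, D = ENNReal.ofReal (2 ^ N) * ENNReal.ofReal (2 ^ κ) := ⟨_, rfl⟩
  have hDt : D ≠ ⊤ := by
    rw [hD]; exact ENNReal.mul_ne_top ENNReal.ofReal_ne_top ENNReal.ofReal_ne_top
  have hD1 : 1 ≤ D := by
    rw [hD, ← ENNReal.ofReal_mul (by positivity)]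
    have : (1 : ℝ) ≤ 2 ^ N * 2 ^ κ :=
      one_le_mul_of_one_le_of_one_le (one_le_pow₀ (by norm_num))
        (Real.one_le_rpow (by norm_num) hκ0.le)
    simpa using ENNReal.ofReal_le_ofReal this
  refine ⟨(c0 * (C2 * (I0 * C3))) ^ (1 / q) * (D * C0), ?_, ?_⟩
  · refine ENNReal.mul_ne_top (ENNReal.rpow_ne_top_of_nonneg (by positivity) ?_)
      (ENNReal.mul_ne_top hDt hC0)
    exact ENNReal.mul_ne_top hc0t (ENNReal.mul_ne_top hC2 (ENNReal.mul_ne_top hI hC3))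
  intro G T hG hT
  obtain ⟨K, hK⟩ : ∃ K, K = morreyQ n p q G := ⟨_, rfl⟩
  rw [← hK]
  unfold morreyWQ
  refine iSup₂_le fun β hβ => ?_
  have hβ0 : (β : ℝ≥0∞) ≠ 0 := by exact_mod_cast hβ.ne'
  have hβt : (β : ℝ≥0∞) ≠ ⊤ := ENNReal.coe_ne_top
  unfold morreyQ
  simp_rw [ENNReal.mul_iSup]
  refine iSup_le fun x0 => iSup_le fun R => iSup_le fun hR => ?_
  obtain ⟨v, hv⟩ : ∃ v, v = volume (Metric.ball x0 R) := ⟨_, rfl⟩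
  have hv0 : v ≠ 0 := by rw [hv]; exact (Metric.measure_ball_pos _ _ hR).ne'
  have hvt : v ≠ ⊤ := by rw [hv]; exact measure_ball_lt_top.ne
  obtain ⟨s, hs⟩ : ∃ s : En n → ℝ≥0∞, s = fun y => D * ((β : ℝ≥0∞)⁻¹ * C0) * AA N q G y :=
    ⟨_, rfl⟩
  have hsm : Measurable s := by rw [hs]; exact (AA_measurable N q G hG).const_mul _
  have hpt : ∀ x, ({x | (β : ℝ≥0∞) < T x}.indicator 1 x : ℝ≥0∞) ^ q ≤
      c0 * ∫⁻ y, min (s y * ENNReal.ofReal (bb κ (x - y))) 1 := by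
    intro x
    by_cases hx : (β : ℝ≥0∞) < T x
    · rw [indicator_of_mem (by exact hx)]
      simp only [Pi.one_apply, ENNReal.one_rpow]
      have h1 := one_le_min D hD1
        (fun y => (β : ℝ≥0∞)⁻¹ * (C0 * AA N q G y * ENNReal.ofReal (bb κ (x - y)))) ?_ ?_
      · rw [← hc0] at h1
        refine h1.trans (le_of_eq ?_)
        congr 2 with y
        rw [hs]
        congr 1
        ring
      · intro y y' hyy
        have a1 := AA_slow N q hq0 G y y' hyy
        have a2 : ENNReal.ofReal (bb κ (x - y')) ≤
            ENNReal.ofReal (2 ^ κ) * ENNReal.ofReal (bb κ (x - y)) := by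
          rw [← ENNReal.ofReal_mul (by positivity)]
          exact ENNReal.ofReal_le_ofReal (bb_slow κ hκ0 x y y' hyy)
        calc (β : ℝ≥0∞)⁻¹ * (C0 * AA N q G y' * ENNReal.ofReal (bb κ (x - y')))
            ≤ (β : ℝ≥0∞)⁻¹ * (C0 * (ENNReal.ofReal (2 ^ N) * AA N q G y) *
              (ENNReal.ofReal (2 ^ κ) * ENNReal.ofReal (bb κ (x - y)))) := by
              gcongr
          _ = _ := by rw [hD]; ring
      · rw [lintegral_const_mul' _ _ (by simpa using hβ.ne')]
        have h2 := lt_of_lt_of_le hx (hT x)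
        calc 1 = (β : ℝ≥0∞)⁻¹ * β := (ENNReal.inv_mul_cancel hβ0 hβt).symm
          _ < _ := (ENNReal.mul_lt_mul_iff_right (by simp) (by simpa using hβ.ne')).2 h2
    · rw [indicator_of_notMem (by exact hx), ENNReal.zero_rpow_of_pos hq0]
      exact bot_le
  have hjm : Measurable (fun a : En n × En n =>
      min (s a.2 * ENNReal.ofReal (bb κ (a.1 - a.2))) 1) := by
    refine Measurable.min ?_ measurable_const
    refine (hsm.comp measurable_snd).mul ?_
    exact ((bb_cont (n := n) κ).comp (continuous_fst.sub continuous_snd)).measurable.ennreal_ofReal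
  have hmain : ∫⁻ x in Metric.ball x0 R, ({x | (β : ℝ≥0∞) < T x}.indicator 1 x : ℝ≥0∞) ^ q ≤
      (c0 * (C2 * (I0 * C3))) * (D * ((β : ℝ≥0∞)⁻¹ * C0)) ^ q * (v ^ (1 - q / p) * K ^ q) := by
    calc _ ≤ ∫⁻ x in Metric.ball x0 R,
            c0 * ∫⁻ y, min (s y * ENNReal.ofReal (bb κ (x - y))) 1 := lintegral_mono hpt
      _ = c0 * ∫⁻ x in Metric.ball x0 R,
            ∫⁻ y, min (s y * ENNReal.ofReal (bb κ (x - y))) 1 := lintegral_const_mul' _ _ hc0t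
      _ = c0 * ∫⁻ y, ∫⁻ x in Metric.ball x0 R, min (s y * ENNReal.ofReal (bb κ (x - y))) 1 := by
          rw [lintegral_lintegral_swap hjm.aemeasurable]
      _ ≤ c0 * ∫⁻ y, (C2 * (D * ((β : ℝ≥0∞)⁻¹ * C0)) ^ q) *
            (AA N q G y ^ q * ENNReal.ofReal (ww x0 R y)) := by
          refine mul_le_mul_right (lintegral_mono fun y => ?_) _
          refine (H2 (s y) x0 R hR y).trans (le_of_eq ?_)
          rw [hs]
          simp only
          rw [ENNReal.mul_rpow_of_nonneg _ (AA N q G y) hq0.le]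
          ring
      _ = c0 * ((C2 * (D * ((β : ℝ≥0∞)⁻¹ * C0)) ^ q) *
            ∫⁻ y, (AA N q G y ^ q * ENNReal.ofReal (ww x0 R y))) := by
          rw [lintegral_const_mul']
          refine ENNReal.mul_ne_top hC2 (ENNReal.rpow_ne_top_of_nonneg hq0.le ?_)
          refine ENNReal.mul_ne_top hDt (ENNReal.mul_ne_top ?_ hC0)
          simpa using hβ.ne'
      _ ≤ c0 * ((C2 * (D * ((β : ℝ≥0∞)⁻¹ * C0)) ^ q) *
            (I0 * (C3 * (v ^ (1 - q / p) * K ^ q)))) := by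
          gcongr
          refine (int_Aw N q hq0 hN G hG x0 R hR).trans ?_
          rw [← hI0, hv, hK]
          exact mul_le_mul_right (H3 G hG x0 R hR) _
      _ = _ := by ring
  rw [← hv]
  have hroot := ENNReal.rpow_le_rpow hmain (z := 1 / q) (by positivity)
  rw [ENNReal.mul_rpow_of_nonneg _ _ (by positivity), ENNReal.mul_rpow_of_nonneg _ _ (by positivity),
    ENNReal.mul_rpow_of_nonneg (v ^ (1 - q / p)) _ (by positivity), ← ENNReal.rpow_mul (D * _),
    ← ENNReal.rpow_mul v, ← ENNReal.rpow_mul K, mul_one_div_cancel hq0.ne', ENNReal.rpow_one,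
    ENNReal.rpow_one] at hroot
  have ev : v ^ (1 / p - 1 / q) * v ^ ((1 - q / p) * (1 / q)) = 1 := by
    rw [← ENNReal.rpow_add _ _ hv0 hvt]
    have : (1 / p - 1 / q) + (1 - q / p) * (1 / q) = 0 := by
      have : q * (1 / q) = 1 := mul_one_div_cancel hq0.ne'
      have h3 : q / p * (1 / q) = 1 / p := by
        rw [div_mul_eq_mul_div, this]
      rw [sub_mul, h3]; ring
    rw [this, ENNReal.rpow_zero]
  calc (β : ℝ≥0∞) * (v ^ (1 / p - 1 / q) *
        (∫⁻ x in Metric.ball x0 R, ({x | (β : ℝ≥0∞) < T x}.indicator 1 x : ℝ≥0∞) ^ q) ^ (1 / q))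
      ≤ (β : ℝ≥0∞) * (v ^ (1 / p - 1 / q) * ((c0 * (C2 * (I0 * C3))) ^ (1 / q) *
          (D * ((β : ℝ≥0∞)⁻¹ * C0)) * (v ^ ((1 - q / p) * (1 / q)) * K))) := by
        gcongr
    _ = ((β : ℝ≥0∞) * (β : ℝ≥0∞)⁻¹) * (v ^ (1 / p - 1 / q) * v ^ ((1 - q / p) * (1 / q))) *
          ((c0 * (C2 * (I0 * C3))) ^ (1 / q) * (D * C0) * K) := by ring
    _ = _ := by rw [ev, ENNReal.mul_inv_cancel hβ0 hβt, one_mul, one_mul]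

end WeakConcl

/-! ### Part 11: scaling and conclusion -/

section Concl
open scoped FourierTransform SchwartzMap ContDiff

lemma morreyQ_mono {n : ℕ} (p q : ℝ) (hq0 : 0 < q) (g h : En n → ℝ≥0∞) (hgh : ∀ x, g x ≤ h x) :
    morreyQ n p q g ≤ morreyQ n p q h := by
  unfold morreyQ
  refine iSup_mono fun x => iSup_mono fun r => iSup_mono fun hr => ?_
  refine mul_le_mul_right (ENNReal.rpow_le_rpow (lintegral_mono fun y => ?_) (by positivity)) _
  exact ENNReal.rpow_le_rpow (hgh y) hq0.le

lemma morreyQ_scale {n : ℕ} (p q : ℝ) (hq0 : 0 < q) (g : En n → ℝ≥0∞) (c : ℝ) (hc : 0 < c) :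
    morreyQ n p q (fun x => g (c • x)) ≤
      ENNReal.ofReal ((c ^ n)⁻¹) ^ (1 / p) * morreyQ n p q g := by
  obtain ⟨a, ha⟩ : ∃ a, a = ENNReal.ofReal ((c ^ n)⁻¹) := ⟨_, rfl⟩
  have ha0 : a ≠ 0 := by
    rw [ha]; simpa using by positivity
  have hat : a ≠ ⊤ := by rw [ha]; exact ENNReal.ofReal_ne_top
  rw [← ha]
  unfold morreyQ
  refine iSup_le fun x => iSup_le fun r => iSup_le fun hr => ?_
  have hcr : 0 < c * r := by positivity
  have hmem : ∀ y, c • y ∈ Metric.ball (c • x) (c * r) ↔ y ∈ Metric.ball x r := by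
    intro y
    rw [mem_ball_iff_norm, mem_ball_iff_norm, ← smul_sub, norm_smul,
      Real.norm_of_nonneg hc.le, mul_lt_mul_iff_right₀ hc]
  have hIntg : ∫⁻ y in Metric.ball x r, g (c • y) ^ q =
      a * ∫⁻ y in Metric.ball (c • x) (c * r), g y ^ q := by
    rw [← lintegral_indicator measurableSet_ball, ← lintegral_indicator measurableSet_ball, ha,
      ← lintegral_smul_subst c hc]
    congr 1 with y
    by_cases hy : y ∈ Metric.ball x r
    · rw [indicator_of_mem hy, indicator_of_mem ((hmem y).2 hy)]
    · rw [indicator_of_notMem hy, indicator_of_notMem fun h => hy ((hmem y).1 h)]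
  have hvol : volume (Metric.ball x r) = a * volume (Metric.ball (c • x) (c * r)) := by
    rw [vol_ball x hr, vol_ball (c • x) hcr, ← mul_assoc, ha, ← ENNReal.ofReal_mul (by positivity)]
    congr 2
    rw [mul_pow, inv_mul_cancel_left₀ (by positivity)]
  have hv0 : volume (Metric.ball (c • x) (c * r)) ≠ 0 := (Metric.measure_ball_pos _ _ hcr).ne'
  have hvt : volume (Metric.ball (c • x) (c * r)) ≠ ⊤ := measure_ball_lt_top.ne
  simp only
  rw [hIntg, hvol, ENNReal.mul_rpow_of_ne_top hat hvt, ENNReal.mul_rpow_of_nonneg a _ (by positivity)]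
  have e : a ^ (1 / p) = a ^ (1 / p - 1 / q) * a ^ (1 / q) := by
    rw [← ENNReal.rpow_add _ _ ha0 hat]; congr 1; ring
  calc _ = a ^ (1 / p) * (volume (Metric.ball (c • x) (c * r)) ^ (1 / p - 1 / q) *
        (∫⁻ y in Metric.ball (c • x) (c * r), g y ^ q) ^ (1 / q)) := by rw [e]; ring
    _ ≤ _ := by
      refine mul_le_mul_right ?_ _
      exact le_iSup_of_le (c • x) (le_iSup_of_le (c * r) (le_iSup_of_le hcr le_rfl))

lemma morreyWQ_scale {n : ℕ} (p q : ℝ) (hq0 : 0 < q) (g : En n → ℝ≥0∞) (c : ℝ) (hc : 0 < c) :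
    morreyWQ n p q (fun x => g (c • x)) ≤
      ENNReal.ofReal ((c ^ n)⁻¹) ^ (1 / p) * morreyWQ n p q g := by
  unfold morreyWQ
  refine iSup₂_le fun β hβ => ?_
  have h := morreyQ_scale p q hq0 ({x | (β : ℝ≥0∞) < g x}.indicator 1) c hc
  have e : (fun x => ({x | (β : ℝ≥0∞) < g x}.indicator 1 (c • x) : ℝ≥0∞)) =
      {x | (β : ℝ≥0∞) < g (c • x)}.indicator 1 := by
    ext x
    simp [indicator]
  rw [e] at h
  calc _ ≤ (β : ℝ≥0∞) * (ENNReal.ofReal ((c ^ n)⁻¹) ^ (1 / p) *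
        morreyQ n p q ({x | (β : ℝ≥0∞) < g x}.indicator 1)) := mul_le_mul_right h _
    _ = ENNReal.ofReal ((c ^ n)⁻¹) ^ (1 / p) * ((β : ℝ≥0∞) *
        morreyQ n p q ({x | (β : ℝ≥0∞) < g x}.indicator 1)) := by ring
    _ ≤ _ := by
      refine mul_le_mul_right ?_ _
      exact le_iSup₂ (f := fun (β : ℝ≥0) (_ : 0 < β) => (β : ℝ≥0∞) *
        morreyQ n p q ({x | (β : ℝ≥0∞) < g x}.indicator 1)) β hβ

lemma brMeans_scale {n : ℕ} (δ ε : ℝ) (hε : 0 < ε) (f : Sch n) (x : En n) :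
    brMeans n δ ε f x = brMeans n δ 1 (scS ε hε f) (ε⁻¹ • x) := by
  rw [brMeans_one]
  unfold brMeans brKernelDil
  have H := Measure.integral_comp_smul_of_nonneg (volume : Measure (En n))
    (fun y : En n => f y * brKernel n δ (ε⁻¹ • (x - y))) ε (hR := hε.le)
  have e1 : ∀ y, scS ε hε f y * brKernel n δ (ε⁻¹ • x - y) =
      f (ε • y) * brKernel n δ (ε⁻¹ • (x - ε • y)) := by
    intro y
    rw [scS_apply, smul_sub, smul_smul ε⁻¹ ε, inv_mul_cancel₀ hε.ne', one_smul]
  simp_rw [e1]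
  rw [H, ← integral_smul]
  congr 1 with y
  simp only [finrank_euclideanSpace, Fintype.card_fin]
  rw [mul_smul_comm]

lemma le_radMax {n : ℕ} (Φ f : Sch n) (t : ℝ) (ht : 0 < t) (x : En n) :
    ‖cv (dilS t ht Φ) f x‖ₑ ≤ radMax n Φ f x := by
  rw [cv_apply]
  simp_rw [dilS_apply]
  unfold radMax
  exact le_iSup₂_of_le t ht le_rfl

lemma radMax_scale {n : ℕ} (Φ f : Sch n) (ε : ℝ) (hε : 0 < ε) (x : En n) :
    radMax n Φ (scS ε hε f) x ≤ radMax n Φ f (ε • x) := by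
  conv_lhs => unfold radMax
  refine iSup₂_le fun t ht => ?_
  have h := le_radMax Φ f (t * ε) (mul_pos ht hε) (ε • x)
  rw [← cv_dil_scS Φ f t ε ht hε x, cv_apply] at h
  simp_rw [dilS_apply] at h
  exact h

lemma GG_le_radMax {n : ℕ} (Φ f : Sch n) (t : ℝ) (ht : 0 < t) (x : En n) :
    GG (dilS t ht Φ) f x ≤ radMax n Φ f x := by
  unfold GG
  refine iSup_le fun j => ?_
  have h := le_radMax Φ f ((2⁻¹ : ℝ) ^ j * t) (mul_pos (half_pow_pos j) ht) x
  have e : vv (dilS t ht Φ) f j = cv (dilS ((2⁻¹ : ℝ) ^ j * t) (mul_pos (half_pow_pos j) ht) Φ) f := by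
    unfold vv
    congr 1
    ext y
    rw [dilS_apply, dilS_apply, dilS_apply, smul_smul, smul_smul, mul_pow, mul_inv, mul_inv,
      mul_comm t⁻¹]
  rw [e]
  exact h

lemma exists_dil {n : ℕ} (Φ : Sch n) (hΦ : (∫ x, Φ x) ≠ 0) :
    ∃ (t : ℝ) (ht : 0 < t), ∀ ξ, ‖ξ‖ ≤ 3 → 𝓕 (dilS t ht Φ) ξ ≠ 0 := by
  have h0 : 𝓕 Φ 0 ≠ 0 := by
    rw [SchwartzMap.fourier_coe, Real.fourier_eq]
    simpa using hΦ
  have hc : ∀ᶠ ξ in nhds (0 : En n), 𝓕 Φ ξ ≠ 0 :=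
    (𝓕 Φ).continuous.continuousAt.eventually_ne h0
  obtain ⟨r, hr, hb⟩ := Metric.eventually_nhds_iff.1 hc
  refine ⟨r / 4, by positivity, fun ξ hξ => ?_⟩
  rw [fourier_dilS]
  refine hb ?_
  rw [dist_zero_right, norm_smul, Real.norm_of_nonneg (by positivity)]
  nlinarith

end Concl

theorem bochnerRiesz_hardyMorrey_to_weakMorrey {n : ℕ} (hn : 1 ≤ n) (δ p q : ℝ)
    (hδ : ((n : ℝ) - 1) / 2 < δ)
    (hq0 : 0 < q) (hq1 : q ≤ 1) (hqp : q ≤ p)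
    (hlow : 2 * (n : ℝ) / ((n : ℝ) + 1 + 2 * δ) ≤ q)
    (Φ : SchwartzMap (En n) ℂ) (hΦ : (∫ x, Φ x) ≠ 0) :
    ∃ C : ℝ≥0, 0 < C ∧ ∀ (f : SchwartzMap (En n) ℂ) (ε : ℝ), 0 < ε →
      morreyWQ n p q (fun x => (‖brMeans n δ ε (⇑f) x‖₊ : ℝ≥0∞)) ≤
        (C : ℝ≥0∞) * morreyQ n p q (radMax n (⇑Φ) (⇑f)) := by
  have hn1 : (1 : ℝ) ≤ n := by exact_mod_cast hn
  have hδ0 : 0 < δ := by linarith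
  obtain ⟨t, ht, hΨ⟩ := exists_dil Φ hΦ
  obtain ⟨N, hN⟩ := exists_nat_ge ((2 * (n : ℝ) + 1) / q)
  rw [div_le_iff₀ hq0] at hN
  obtain ⟨C0, hC0, H0⟩ := brMeans_bound hn δ hδ0 (dilS t ht Φ) hΨ N q hq0 hq1
  have hqc : (n : ℝ) / (((n : ℝ) + 1) / 2 + δ) ≤ q := by
    refine le_trans (le_of_eq ?_) hlow
    rw [div_eq_div_iff (by positivity) (by positivity)]
    ring
  obtain ⟨C, hC, H⟩ := weak_type hn (((n : ℝ) + 1) / 2 + δ) (by linarith) p q hq0 hq1 hqp hqc N hN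
    C0 hC0
  refine ⟨C.toNNReal + 1, by positivity, fun f ε hε => ?_⟩
  have hCC : C ≤ ((C.toNNReal + 1 : ℝ≥0) : ℝ≥0∞) := by
    rw [ENNReal.coe_add, ENNReal.coe_toNNReal hC]; exact le_self_add
  have e1 : (fun x => (‖brMeans n δ ε f x‖₊ : ℝ≥0∞)) =
      fun x => (fun y => ‖brMeans n δ 1 (scS ε hε f) y‖ₑ) (ε⁻¹ • x) := by
    ext x
    rw [brMeans_scale δ ε hε f x]
    rfl
  have e2 : ENNReal.ofReal ((ε⁻¹ ^ n)⁻¹) ^ (1 / p) * ENNReal.ofReal ((ε ^ n)⁻¹) ^ (1 / p) = 1 := by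
    have hp : 0 < p := by linarith
    rw [← ENNReal.mul_rpow_of_nonneg _ _ (by positivity), ← ENNReal.ofReal_mul (by positivity),
      inv_pow, inv_inv, mul_inv_cancel₀ (by positivity)]
    simp
  rw [e1]
  calc _ ≤ ENNReal.ofReal ((ε⁻¹ ^ n)⁻¹) ^ (1 / p) *
        morreyWQ n p q (fun y => ‖brMeans n δ 1 (scS ε hε f) y‖ₑ) :=
        morreyWQ_scale p q hq0 _ ε⁻¹ (inv_pos.2 hε)
    _ ≤ ENNReal.ofReal ((ε⁻¹ ^ n)⁻¹) ^ (1 / p) *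
        (C * morreyQ n p q (GG (dilS t ht Φ) (scS ε hε f))) := by
        refine mul_le_mul_right ?_ _
        exact H _ _ (GG_measurable _ _) (fun x => H0 (scS ε hε f) x)
    _ ≤ ENNReal.ofReal ((ε⁻¹ ^ n)⁻¹) ^ (1 / p) * (C *
        (ENNReal.ofReal ((ε ^ n)⁻¹) ^ (1 / p) * morreyQ n p q (radMax n Φ f))) := by
        refine mul_le_mul_right (mul_le_mul_right ?_ _) _
        refine le_trans (morreyQ_mono p q hq0 _ _ fun x => ?_)
          (morreyQ_scale p q hq0 (radMax n Φ f) ε hε)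
        exact (GG_le_radMax Φ _ t ht x).trans (radMax_scale Φ f ε hε x)
    _ = (ENNReal.ofReal ((ε⁻¹ ^ n)⁻¹) ^ (1 / p) * ENNReal.ofReal ((ε ^ n)⁻¹) ^ (1 / p)) *
        (C * morreyQ n p q (radMax n Φ f)) := by ring
    _ ≤ _ := by
        rw [e2, one_mul]
        exact mul_le_mul_left hCC _
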